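/- arXiv:1003.4561 — 4 statements merged into one kernel-verified Lean document; each statement's English description precedes it below -/
import Mathlib

section
/- For all positive integers g and k, there exists a finite set A ⊆ ℤ such that: (i) A is a B₂°[2] set; (ii) A is the union of k B₂[1] sets; and (iii) A cannot be written as the union of k − 1 B₂[g] sets. -/
/-- `S ⊆ G` is a `B₂[g]` set: every element has at most `g` representations as a sum
`a + b` with `a, b ∈ S`, counting representations differing only in order as one. -/
def IsB2 {G : Type} [AddCommGroup G] (g : ℕ) (S : Set G) : Prop :=
  ∀ ξ : G, {p : Sym2 G | ∃ a ∈ S, ∃ b ∈ S, p = s(a, b) ∧ a + b = ξ}.encard ≤ g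

/-- `S ⊆ G` is a `B₂°[g]` set: every nonzero element has at most `g` representations
as a difference `a - b` with `a, b ∈ S`. -/
def IsB2Circ {G : Type} [AddCommGroup G] (g : ℕ) (S : Set G) : Prop :=
  ∀ ξ : G, ξ ≠ 0 → {p : G × G | p.1 ∈ S ∧ p.2 ∈ S ∧ p.1 - p.2 = ξ}.encard ≤ g

namespace Stmt6

abbrev Edge (k : ℕ) := {p : Fin k × Fin k // p.1 < p.2}
abbrev W (k n : ℕ) := Edge k → Fin (n + 1)

def sg (b : Bool) : ℤ := if b then 1 else -1

def mask {k n : ℕ} (ε : Fin k → Bool) (w : W k n) : W k n :=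
  fun e => if ε e.1.1 = ε e.1.2 then 0 else w e

def H {k n : ℕ} (i : Fin k) (w : W k n) : (Fin k → Bool) × W k n → ℤ :=
  fun q => if mask q.1 w = q.2 then sg (q.1 i) else 0

lemma base9 (n : ℕ) : ∀ f : Fin n → ℤ, (∀ i, |f i| ≤ 4) →
    ∑ i, f i * 9 ^ (i : ℕ) = 0 → f = 0 := by
  induction n with
  | zero => intro f _ _; exact Subsingleton.elim _ _
  | succ n ih =>
    intro f hf hs
    rw [Fin.sum_univ_succ] at hs
    have h2 : ∑ i : Fin n, f i.succ * 9 ^ ((i.succ : Fin (n+1)) : ℕ)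
        = 9 * ∑ i : Fin n, f i.succ * 9 ^ (i : ℕ) := by
      rw [Finset.mul_sum]
      refine Finset.sum_congr rfl fun i _ => ?_
      rw [Fin.val_succ, pow_succ]; ring
    rw [h2] at hs
    have h0 := abs_le.1 (hf 0)
    simp only [Fin.val_zero, pow_zero, mul_one] at hs
    have hz : f 0 = 0 := by omega
    have ht := ih (fun i => f i.succ) (fun i => hf _) (by omega)
    funext i
    refine Fin.cases hz (fun j => ?_) i
    exact congrFun ht j

lemma exists_phi (ι : Type) [Fintype ι] : ∃ φ : (ι → ℤ) →+ ℤ,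
    ∀ f, (∀ q, |f q| ≤ 4) → φ f = 0 → f = 0 := by
  let e := Fintype.equivFin ι
  refine ⟨⟨⟨fun f => ∑ i, f (e.symm i) * 9 ^ (i : ℕ), by simp⟩, ?_⟩, ?_⟩
  · intro f g
    simp [add_mul, Finset.sum_add_distrib]
  · intro f hf h
    have := base9 _ (fun i => f (e.symm i)) (fun i => hf _) h
    funext q
    simpa using congrFun this (e q)

lemma H_bound {k n : ℕ} (i : Fin k) (w : W k n) (q) : |H i w q| ≤ 1 := by
  unfold H sg; split_ifs <;> simp

/-- two pairs can be separated by one cut -/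
lemma cut2 {k : ℕ} {a b c d : Fin k} (h : a ≠ b) (h' : c ≠ d) :
    ∃ ε : Fin k → Bool, ε a ≠ ε b ∧ ε c ≠ ε d := by
  by_cases h1 : a = c ∨ a = d
  · exact ⟨fun x => decide (x = a), by simp; grind⟩
  by_cases h2 : b = c ∨ b = d
  · exact ⟨fun x => decide (x = b), by simp; grind⟩
  · exact ⟨fun x => decide (x = a ∨ x = c), by simp; grind⟩

lemma cutsame {k : ℕ} {i j : Fin k} (e : Edge k)
    (h : ¬ ((e.1.1 = i ∧ e.1.2 = j) ∨ (e.1.1 = j ∧ e.1.2 = i))) :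
    ∃ ε : Fin k → Bool, ε i = ε j ∧ ε e.1.1 ≠ ε e.1.2 := by
  have := e.2.ne
  by_cases h1 : e.1.1 = i ∨ e.1.1 = j
  · exact ⟨fun x => decide (x = e.1.2), by simp; grind⟩
  · exact ⟨fun x => decide (x = e.1.1), by simp; grind⟩

lemma mask_eq {k n : ℕ} {ε : Fin k → Bool} {w v : W k n} (h : mask ε w = mask ε v)
    (e : Edge k) (he : ε e.1.1 ≠ ε e.1.2) : w e = v e := by
  have := congrFun h e
  simpa [mask, he] using this

lemma sg_cases (b : Bool) : sg b = 1 ∨ sg b = -1 := by cases b <;> simp [sg]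

lemma sg_inj {b c : Bool} : sg b = sg c ↔ b = c := by cases b <;> cases c <;> simp [sg]

lemma blkA {U : Type} [DecidableEq U] {a b a' b' : U} {s : ℤ} (hs : s = 1 ∨ s = -1)
    (h : ∀ u, (if a = u then s else 0) - (if b = u then s else 0)
      = (if a' = u then s else 0) - (if b' = u then s else 0)) :
    (a = b ∧ a' = b') ∨ (a = a' ∧ b = b') := by
  have h1 := h a
  have h2 := h b
  have h3 := h a'
  have h4 := h b'
  grind

lemma blkB {U : Type} [DecidableEq U] {a b a' b' : U} {s t : ℤ} (hs : s = 1 ∨ s = -1)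
    (ht : t = -s)
    (h : ∀ u, (if a = u then s else 0) - (if b = u then t else 0)
      = (if a' = u then s else 0) - (if b' = u then t else 0)) :
    (a = a' ∧ b = b') ∨ (a = b' ∧ b = a') := by
  have h1 := h a
  have h2 := h b
  have h3 := h a'
  have h4 := h b'
  grind

lemma sg_neg {b c : Bool} (h : b ≠ c) : sg c = - sg b := by
  cases b <;> cases c <;> simp_all [sg]

variable {k n : ℕ}

lemma block {i j i' j' : Fin k} {w v w' v' : W k n}
    (h : H i w - H j v = H i' w' - H j' v') (ε : Fin k → Bool) (u : W k n) :
    (if mask ε w = u then sg (ε i) else 0) - (if mask ε v = u then sg (ε j) else 0)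
      = (if mask ε w' = u then sg (ε i') else 0) - (if mask ε v' = u then sg (ε j') else 0) :=
  congrFun h (ε, u)

lemma signs {i j i' j' : Fin k} {w v w' v' : W k n}
    (h : H i w - H j v = H i' w' - H j' v') (ε : Fin k → Bool) :
    sg (ε i) - sg (ε j) = sg (ε i') - sg (ε j') := by
  have := Finset.sum_congr (rfl : (Finset.univ : Finset (W k n)) = Finset.univ)
    (fun u _ => block h ε u)
  simpa [Finset.sum_sub_distrib] using this

lemma idx_ne {i j i' j' : Fin k} {w v w' v' : W k n}
    (h : H i w - H j v = H i' w' - H j' v') (hij : i ≠ j) : i' = i ∧ j' = j := by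
  have h1 := signs h (fun x => decide (x = i))
  have h2 := signs h (fun x => decide (x = j))
  simp [sg] at h1 h2
  grind

lemma idx_eq {i i' j' : Fin k} {w v w' v' : W k n}
    (h : H i w - H i v = H i' w' - H j' v') : j' = i' := by
  by_contra hne
  have := idx_ne h.symm (fun h => hne h.symm)
  grind

lemma sameSign {i j i' j' : Fin k} {w v w' v' : W k n}
    (h : H i w - H j v = H i' w' - H j' v') (ε : Fin k → Bool)
    (h1 : ε i = ε j) (h2 : ε i' = ε i) (h3 : ε j' = ε i) :
    (mask ε w = mask ε v ∧ mask ε w' = mask ε v') ∨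
    (mask ε w = mask ε w' ∧ mask ε v = mask ε v') := by
  refine blkA (sg_cases (ε i)) fun u => ?_
  have := block h ε u
  rwa [← h1, h2, h3] at this

lemma diffSign {i j : Fin k} {w v w' v' : W k n}
    (h : H i w - H j v = H i w' - H j v') (ε : Fin k → Bool) (h1 : ε i ≠ ε j) :
    (mask ε w = mask ε w' ∧ mask ε v = mask ε v') ∨
    (mask ε w = mask ε v' ∧ mask ε v = mask ε w') :=
  blkB (sg_cases (ε i)) (sg_neg h1) (block h ε)

lemma D1 {i j : Fin k} {w v w' v' : W k n} (hij : i ≠ j)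
    (h : H i w - H j v = H i w' - H j v') :
    (∀ e : Edge k, ¬ ((e.1.1 = i ∧ e.1.2 = j) ∨ (e.1.1 = j ∧ e.1.2 = i)) →
      w' e = w e ∧ v' e = v e) ∧
    (∀ e : Edge k, (w' e = w e ∧ v' e = v e) ∨ (w' e = v e ∧ v' e = w e)) := by
  have key : ∀ e : Edge k, (w' e = w e ∧ v' e = v e) ∨ (w' e = v e ∧ v' e = w e) := by
    intro e
    obtain ⟨ε, h1, h2⟩ := cut2 hij e.2.ne
    rcases diffSign h ε h1 with ⟨a, b⟩ | ⟨a, b⟩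
    · exact Or.inl ⟨(mask_eq a e h2).symm, (mask_eq b e h2).symm⟩
    · exact Or.inr ⟨(mask_eq b e h2).symm, (mask_eq a e h2).symm⟩
  refine ⟨fun e he => ?_, key⟩
  obtain ⟨ε, h1, h2⟩ := cutsame e he
  rcases sameSign h ε h1 rfl h1.symm with ⟨a, b⟩ | ⟨a, b⟩
  · have := mask_eq a e h2
    have := key e
    grind
  · exact ⟨(mask_eq a e h2).symm, (mask_eq b e h2).symm⟩

lemma D2 {i : Fin k} {w v w' v' : W k n} (hwv : w ≠ v)
    (h : H i w - H i v = H i w' - H i v') : w' = w ∧ v' = v := by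
  obtain ⟨f, hf⟩ := Function.ne_iff.1 hwv
  have key : ∀ e, w' e = w e ∧ v' e = v e := by
    intro e
    obtain ⟨ε, h1, h2⟩ := cut2 e.2.ne f.2.ne
    rcases sameSign h ε rfl rfl rfl with ⟨a, b⟩ | ⟨a, b⟩
    · exact absurd (mask_eq a f h2) hf
    · exact ⟨(mask_eq a e h1).symm, (mask_eq b e h1).symm⟩
  exact ⟨funext fun e => (key e).1, funext fun e => (key e).2⟩

lemma D3 {i i' : Fin k} {w v w' v' : W k n} (hi : i ≠ i')
    (h : H i w - H i v = H i' w' - H i' v') (e : Edge k) (he : w e ≠ v e) :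
    (e.1.1 = i ∧ e.1.2 = i') ∨ (e.1.1 = i' ∧ e.1.2 = i) := by
  by_contra hn
  obtain ⟨ε, h1, h2⟩ := cutsame e hn
  obtain ⟨δ, h3, h4⟩ := cut2 hi e.2.ne
  rcases sameSign h ε rfl h1.symm h1.symm with ⟨a, b⟩ | ⟨a, b⟩
  · exact he (mask_eq a e h2)
  have a1 := mask_eq a e h2
  have b1 := mask_eq b e h2
  have hb := block h δ
  rw [sg_neg h3] at hb
  have h5 := hb (mask δ w)
  have n1 : mask δ v ≠ mask δ w := fun h => he (mask_eq h e h4).symm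
  have n2 : mask δ v' ≠ mask δ w := fun h => he (by rw [b1]; exact (mask_eq h e h4).symm)
  have := sg_cases (δ i)
  have n3 : mask δ w' ≠ mask δ v' := fun h => he (by rw [a1, b1]; exact mask_eq h e h4)
  grind

lemma sidon {i : Fin k} {w v w' v' : W k n}
    (h : H i w - H i w' = H i v' - H i v) : (w = w' ∧ v' = v) ∨ (w = v' ∧ w' = v) := by
  by_cases hw : w = w'
  · by_cases hv : v' = v
    · exact Or.inl ⟨hw, hv⟩
    · have := D2 hv h.symm
      exact Or.inr ⟨this.1, this.2⟩
  · have := D2 hw h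
    exact Or.inr ⟨this.1.symm, this.2.symm⟩

lemma sum_const (e : Edge k) {w w' : W k n} (h : ∀ f, f ≠ e → w f = w' f) :
    H e.1.1 w + H e.1.2 w = H e.1.1 w' + H e.1.2 w' := by
  funext ⟨ε, u⟩
  simp only [Pi.add_apply, H]
  by_cases hs : ε e.1.1 = ε e.1.2
  · have : mask ε w = mask ε w' := by
      funext f
      by_cases hf : f = e
      · subst hf; simp [mask, hs]
      · simp [mask, h f hf]
    rw [this]
  · rw [sg_neg hs]; split_ifs <;> simp

lemma encard_le_two {α : Type} {P : Set α}
    (h : ∀ a ∈ P, ∀ b ∈ P, ∀ c ∈ P, a = b ∨ b = c ∨ a = c) : P.encard ≤ 2 := by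
  by_contra hc
  push Not at hc
  have h3 : (3 : ℕ∞) ≤ P.encard := by
    have := Order.add_one_le_of_lt hc
    rwa [show (2 : ℕ∞) + 1 = 3 by norm_num] at this
  obtain ⟨t, ht, ht3⟩ := Set.exists_subset_encard_eq h3
  obtain ⟨a, b, c, h1, h2, h4, rfl⟩ := Set.encard_eq_three.1 ht3
  have := h a (ht (by simp)) b (ht (by simp)) c (ht (by simp))
  grind

lemma encard_le_one' {α : Type} {P : Set α}
    (h : ∀ a ∈ P, ∀ b ∈ P, a = b) : P.encard ≤ 1 :=
  Set.encard_le_one_iff.2 fun a b ha hb => h a ha b hb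

end Stmt6

open Stmt6 in
theorem stmt_6 :
    ∀ g k : ℕ, 0 < g → 0 < k → ∃ A : Set ℤ,
      A.Finite ∧
      IsB2Circ 2 A ∧
      (∃ T : Fin k → Set ℤ, (∀ i, IsB2 1 (T i)) ∧ A = ⋃ i, T i) ∧
      ¬ ∃ T : Fin (k - 1) → Set ℤ, (∀ i, IsB2 g (T i)) ∧ A = ⋃ i, T i := by
  intro g k hg hk
  let n := Fintype.card (Edge k) * (k - 1) * g
  obtain ⟨φ, hφ⟩ := exists_phi ((Fin k → Bool) × W k n)
  let x : Fin k → W k n → ℤ := fun i w => φ (H i w)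
  have lift : ∀ {i j i' j' : Fin k} {w v w' v' : W k n},
      x i w - x j v = x i' w' - x j' v' → H i w - H j v = H i' w' - H j' v' := by
    intro i j i' j' w v w' v' h
    rw [← sub_eq_zero]
    apply hφ
    · intro q
      have h1 := abs_le.1 (H_bound i w q)
      have h2 := abs_le.1 (H_bound j v q)
      have h3 := abs_le.1 (H_bound i' w' q)
      have h4 := abs_le.1 (H_bound j' v' q)
      simp only [Pi.sub_apply]
      rw [abs_le]; constructor <;> linarith
    · simp only [map_sub]
      exact sub_eq_zero.2 h
  have xinj : ∀ {i : Fin k} {w v : W k n}, x i w = x i v → w = v := by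
    intro i w v h
    have : H i w - H i v = H i v - H i v := lift (by rw [h])
    by_contra hne
    have := D2 hne this
    exact hne this.1.symm
  refine ⟨⋃ i, Set.range (x i), ?_, ?_, ⟨fun i => Set.range (x i), ?_, rfl⟩, ?_⟩
  · exact Set.finite_iUnion fun i => Set.finite_range _
  · intro ξ hξ
    refine encard_le_two ?_
    rintro ⟨a1, b1⟩ ⟨ha1, hb1, h1⟩ ⟨a2, b2⟩ ⟨ha2, hb2, h2⟩ ⟨a3, b3⟩ ⟨ha3, hb3, h3⟩
    simp only [Set.mem_iUnion, Set.mem_range] at ha1 hb1 ha2 hb2 ha3 hb3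
    obtain ⟨i1, w1, rfl⟩ := ha1
    obtain ⟨j1, v1, rfl⟩ := hb1
    obtain ⟨i2, w2, rfl⟩ := ha2
    obtain ⟨j2, v2, rfl⟩ := hb2
    obtain ⟨i3, w3, rfl⟩ := ha3
    obtain ⟨j3, v3, rfl⟩ := hb3
    have e12 := lift (h1.trans h2.symm)
    have e13 := lift (h1.trans h3.symm)
    have e23 := lift (h2.trans h3.symm)
    by_cases hij : i1 = j1
    · subst hij
      obtain rfl := idx_eq e12
      obtain rfl := idx_eq e13
      have hne1 : w1 ≠ v1 := by rintro rfl; exact hξ (by simpa using h1.symm)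
      have hne2 : w2 ≠ v2 := by rintro rfl; exact hξ (by simpa using h2.symm)
      by_cases c12 : i1 = j2
      · subst c12
        obtain ⟨rfl, rfl⟩ := D2 hne1 e12
        exact Or.inl rfl
      by_cases c13 : i1 = j3
      · subst c13
        obtain ⟨rfl, rfl⟩ := D2 hne1 e13
        exact Or.inr (Or.inr rfl)
      by_cases c23 : j2 = j3
      · subst c23
        obtain ⟨rfl, rfl⟩ := D2 hne2 e23
        exact Or.inr (Or.inl rfl)
      obtain ⟨e, he⟩ := Function.ne_iff.1 hne1
      have q1 := D3 c12 e12 e he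
      have q2 := D3 c13 e13 e he
      grind
    · obtain ⟨rfl, rfl⟩ := idx_ne e12 hij
      obtain ⟨rfl, rfl⟩ := idx_ne e13 hij
      obtain ⟨p2, r2⟩ := D1 hij e12
      obtain ⟨p3, r3⟩ := D1 hij e13
      obtain ⟨e, he⟩ : ∃ e : Edge k, (e.1.1 = i3 ∧ e.1.2 = j3) ∨ (e.1.1 = j3 ∧ e.1.2 = i3) := by
        rcases lt_or_gt_of_ne hij with h | h
        · exact ⟨⟨(i3, j3), h⟩, Or.inl ⟨rfl, rfl⟩⟩
        · exact ⟨⟨(j3, i3), h⟩, Or.inr ⟨rfl, rfl⟩⟩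
      have huniq : ∀ f : Edge k,
          ((f.1.1 = i3 ∧ f.1.2 = j3) ∨ (f.1.1 = j3 ∧ f.1.2 = i3)) → f = e := by
        rintro ⟨⟨a, b⟩, hab⟩ hf
        obtain ⟨⟨c, d⟩, hcd⟩ := e
        simp only at hab hcd hf he
        rw [Subtype.mk.injEq, Prod.mk.injEq]
        have := hab.le
        have := hab.ne
        have := hcd.ne
        rcases hf with ⟨rfl, rfl⟩ | ⟨rfl, rfl⟩ <;> rcases he with ⟨rfl, rfl⟩ | ⟨rfl, rfl⟩
        · simp
        · exact absurd hab hcd.asymm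
        · exact absurd hab hcd.asymm
        · simp
      have p2' : ∀ f, f ≠ e → w2 f = w1 f ∧ v2 f = v1 f := fun f hf => p2 f fun h => hf (huniq f h)
      have p3' : ∀ f, f ≠ e → w3 f = w1 f ∧ v3 f = v1 f := fun f hf => p3 f fun h => hf (huniq f h)
      have ext2 : ∀ {w w' v v' : W k n}, (∀ f, f ≠ e → w f = w' f ∧ v f = v' f) →
          w e = w' e ∧ v e = v' e → (x i3 w, x j3 v) = (x i3 w', x j3 v') := by
        intro w w' v v' h h'
        have : w = w' := by
          funext f
          by_cases hf : f = e
          · rw [hf]; exact h'.1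
          · exact (h f hf).1
        have h2 : v = v' := by
          funext f
          by_cases hf : f = e
          · rw [hf]; exact h'.2
          · exact (h f hf).2
        rw [this, h2]
      rcases r2 e with q2 | q2
      · exact Or.inl (ext2 p2' q2).symm
      rcases r3 e with q3 | q3
      · exact Or.inr (Or.inr (ext2 p3' q3).symm)
      · refine Or.inr (Or.inl (ext2 (fun f hf => ?_) ?_))
        · rw [(p2' f hf).1, (p2' f hf).2, (p3' f hf).1, (p3' f hf).2]; exact ⟨rfl, rfl⟩
        · rw [q2.1, q2.2, q3.1, q3.2]; exact ⟨rfl, rfl⟩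
  · intro i ξ
    refine encard_le_one' ?_
    rintro _ ⟨_, ⟨w, rfl⟩, _, ⟨v, rfl⟩, rfl, h1⟩ _ ⟨_, ⟨w', rfl⟩, _, ⟨v', rfl⟩, rfl, h2⟩
    have : x i w - x i w' = x i v' - x i v := by linarith
    rcases sidon (lift this) with ⟨rfl, rfl⟩ | ⟨rfl, rfl⟩
    · rfl
    · exact Sym2.eq_swap
  · rintro ⟨T, hT, hA⟩
    have hmem : ∀ i w, ∃ c, x i w ∈ T c := by
      intro i w
      have : x i w ∈ ⋃ i, Set.range (x i) := Set.mem_iUnion.2 ⟨i, w, rfl⟩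
      rw [hA] at this
      exact Set.mem_iUnion.1 this
    have hcol : ∀ w, ∃ p : Edge k × Fin (k - 1), x p.1.1.1 w ∈ T p.2 ∧ x p.1.1.2 w ∈ T p.2 := by
      intro w
      choose c hc using fun i => hmem i w
      obtain ⟨i, j, hij, hcc⟩ := Fintype.exists_ne_map_eq_of_card_lt c (by simp; omega)
      rcases lt_or_gt_of_ne hij with h | h
      · exact ⟨(⟨(i, j), h⟩, c i), hc i, by simpa [hcc] using hc j⟩
      · exact ⟨(⟨(j, i), h⟩, c i), by simpa [hcc] using hc j, hc i⟩
    choose col hcol using hcol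
    let Φ : W k n × Fin (n + 1) → (Edge k × Fin (k - 1)) × W k n :=
      fun q => (col q.1, Function.update q.1 (col q.1).1 q.2)
    have hcard : Fintype.card ((Edge k × Fin (k - 1)) × W k n) * g
        < Fintype.card (W k n × Fin (n + 1)) := by
      have hW : 0 < Fintype.card (W k n) := Fintype.card_pos
      rw [Fintype.card_prod, Fintype.card_prod, Fintype.card_prod, Fintype.card_fin,
        Fintype.card_fin]
      calc _ = Fintype.card (W k n) * n := by simp only [n]; ring
        _ < _ := Nat.mul_lt_mul_of_pos_left (Nat.lt_succ_self n) hW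
    obtain ⟨⟨⟨e, c⟩, u⟩, hu⟩ := Fintype.exists_lt_card_fiber_of_mul_lt_card Φ hcard
    set F := Finset.univ.filter (fun q => Φ q = ((e, c), u)) with hF
    have hFm : ∀ q ∈ F, col q.1 = (e, c) ∧ (∀ f, f ≠ e → q.1 f = u f) ∧ q.2 = u e := by
      intro q hq
      have hq' : Φ q = ((e, c), u) := (Finset.mem_filter.1 hq).2
      have h1 : col q.1 = (e, c) := congrArg Prod.fst hq'
      have h2 : Function.update q.1 (col q.1).1 q.2 = u := congrArg Prod.snd hq'
      rw [h1] at h2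
      refine ⟨h1, fun f hf => ?_, ?_⟩
      · rw [← h2, Function.update_of_ne hf]
      · rw [← h2]; simp
    have hconst : ∀ w : W k n, (∀ f, f ≠ e → w f = u f) →
        x e.1.1 w + x e.1.2 w = x e.1.1 u + x e.1.2 u := by
      intro w hw
      simp only [x, ← map_add]
      rw [sum_const e hw]
    let ψ : W k n × Fin (n + 1) → Sym2 ℤ := fun q => s(x e.1.1 q.1, x e.1.2 q.1)
    have hinj : Set.InjOn ψ F := by
      intro q hq q' hq' h
      have hq := hFm q hq
      have hq' := hFm q' hq'
      have : q.1 = q'.1 := by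
        rcases Sym2.eq_iff.1 h with ⟨h, _⟩ | ⟨h, h'⟩
        · exact xinj h
        · exfalso
          have e1 := lift (show x e.1.1 q.1 - x e.1.2 q'.1 = x e.1.2 u - x e.1.2 u by
            rw [h]; simp)
          exact e.2.ne (idx_eq e1.symm).symm
      exact Prod.ext this (by rw [hq.2.2, hq'.2.2])
    have hsub : ((F.image ψ : Finset (Sym2 ℤ)) : Set (Sym2 ℤ)) ⊆
        {p : Sym2 ℤ | ∃ a ∈ T c, ∃ b ∈ T c, p = s(a, b) ∧ a + b = x e.1.1 u + x e.1.2 u} := by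
      intro p hp
      rw [Finset.mem_coe, Finset.mem_image] at hp
      obtain ⟨q, hq, rfl⟩ := hp
      obtain ⟨h1, h2, h3⟩ := hFm q hq
      have := hcol q.1
      rw [h1] at this
      exact ⟨_, this.1, _, this.2, rfl, hconst _ h2⟩
    have hle := (Set.encard_le_encard hsub).trans (hT c _)
    rw [Set.encard_coe_eq_coe_finsetCard, Finset.card_image_of_injOn hinj] at hle
    have : F.card ≤ g := by exact_mod_cast hle
    omega
end

section
/- For every positive integer g and every integer k ≥ 5, there exist finite sets U ⊆ ℤ and V ⊆ ℤ such that U is a B₂[2] set, V is a B₂°[2] set, and for every positive integer m with m ≤ k/3 − 1, the product set U × V ⊆ ℤ² cannot be written as the union of m sets each of which is either a B₂[g] set in ℤ² or a B₂°[g] set in ℤ². -/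
lemma exists_generic {A ι : Type} [Finite A] [Fintype ι] (x : A → ι → ℤ) :
    ∃ f : A → ℤ, ∀ a b c d, f a + f b = f c + f d ↔ x a + x b = x c + x d := by
  classical
  have := Fintype.ofFinite A
  let e := Fintype.equivFin ι
  let P : (ι → ℤ) → Polynomial ℤ := fun w => ∑ i, Polynomial.monomial (e i : ℕ) (w i)
  have hP : ∀ w, w ≠ 0 → P w ≠ 0 := by
    intro w hw h
    apply hw
    funext i
    have := congrArg (fun p => Polynomial.coeff p (e i : ℕ)) h
    simp only [P, Polynomial.finsetSum_coeff, Polynomial.coeff_monomial, Polynomial.coeff_zero] at this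
    rw [Finset.sum_eq_single i] at this
    · simpa using this
    · intro b _ hb
      rw [if_neg]
      intro h'
      exact hb (e.injective (Fin.ext h'))
    · simp
  let D : A × A × A × A → ι → ℤ := fun q => x q.1 + x q.2.1 - x q.2.2.1 - x q.2.2.2
  let R : Polynomial ℤ := ∏ q : A × A × A × A, if D q = 0 then 1 else P (D q)
  have hR : R ≠ 0 := by
    refine Finset.prod_ne_zero_iff.2 ?_
    intro q _
    split_ifs with h
    · exact one_ne_zero
    · exact hP _ h
  obtain ⟨t, ht⟩ : ∃ t, R.eval t ≠ 0 := by
    by_contra! h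
    exact hR (Polynomial.funext (by simpa using h))
  refine ⟨fun a => ∑ i, x a i * t ^ (e i : ℕ), ?_⟩
  intro a b c d
  constructor
  · intro h
    by_contra hne
    have hD : D (a, b, c, d) ≠ 0 := by
      intro h0
      apply hne
      simp only [D] at h0
      rw [sub_sub, sub_eq_zero] at h0
      exact h0
    apply ht
    simp only [R, Polynomial.eval_prod]
    refine Finset.prod_eq_zero (Finset.mem_univ (a, b, c, d)) ?_
    rw [if_neg hD]
    simp only [P, D, Polynomial.eval_finsetSum, Polynomial.eval_monomial, Pi.sub_apply, Pi.add_apply,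
      sub_mul, add_mul, Finset.sum_sub_distrib, Finset.sum_add_distrib]
    linarith
  · intro h
    simp only [← Finset.sum_add_distrib, ← add_mul]
    refine Finset.sum_congr rfl fun i _ => ?_
    have := congrFun h i
    simp only [Pi.add_apply] at this
    rw [this]

lemma exists_U (g : ℕ) (C : Type) [Fintype C] :
    ∃ U : Set ℤ, U.Finite ∧ IsB2 2 U ∧ ∀ χ : ℤ → C, ∃ e ⊆ U, ∃ c, (∀ a ∈ e, χ a = c) ∧
      ¬ IsB2Circ g e := by
  classical
  obtain ⟨n, hn⟩ : ∃ n, n = Fintype.card C + 1 := ⟨_, rfl⟩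
  obtain ⟨L, hL⟩ : ∃ L, L = Fintype.card (Fin n × Fin n × C) * g + 1 := ⟨_, rfl⟩
  let x : Fin n × Fin L → (Fin n ⊕ Fin L) → ℤ := fun a =>
    Pi.single (Sum.inl a.1) 1 + Pi.single (Sum.inr a.2) 1
  obtain ⟨u, hu⟩ := exists_generic x
  have key : ∀ a b c d, u a + u b = u c + u d →
      ((a.1 = c.1 ∧ b.1 = d.1) ∨ (a.1 = d.1 ∧ b.1 = c.1)) ∧
      ((a.2 = c.2 ∧ b.2 = d.2) ∨ (a.2 = d.2 ∧ b.2 = c.2)) := by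
    intro a b c d h
    rw [hu] at h
    constructor
    · have h1 := congrFun h (Sum.inl a.1)
      have h2 := congrFun h (Sum.inl b.1)
      simp [x, Pi.single_apply] at h1 h2
      grind
    · have h1 := congrFun h (Sum.inr a.2)
      have h2 := congrFun h (Sum.inr b.2)
      simp [x, Pi.single_apply] at h1 h2
      grind
  have inj : Function.Injective u := by
    intro a b h
    have := key a a b b (by rw [h])
    grind
  refine ⟨Set.range u, Set.finite_range u, ?_, ?_⟩
  · intro ξ
    by_cases hne : ∃ a b, u a + u b = ξ
    · obtain ⟨a, b, hab⟩ := hne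
      refine le_trans (Set.encard_le_encard (t := {s(u a, u b), s(u (a.1, b.2), u (b.1, a.2))}) ?_)
        (Set.encard_insert_le _ _ |>.trans (by rw [Set.encard_singleton]; norm_num))
      rintro p ⟨_, ⟨c, rfl⟩, _, ⟨d, rfl⟩, rfl, h⟩
      have := key a b c d (hab.trans h.symm)
      obtain ⟨a1, a2⟩ := a
      obtain ⟨b1, b2⟩ := b
      obtain ⟨c1, c2⟩ := c
      obtain ⟨d1, d2⟩ := d
      simp only [Set.mem_insert_iff, Set.mem_singleton_iff, Sym2.eq_iff]
      grind
    · refine le_of_eq_of_le (Set.encard_eq_zero.2 ?_) (by simp)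
      ext p
      simp only [Set.mem_ofPred_eq, Set.mem_empty_iff_false, iff_false]
      rintro ⟨_, ⟨c, rfl⟩, _, ⟨d, rfl⟩, rfl, h⟩
      exact hne ⟨c, d, h⟩
  · intro χ
    have hcol : ∀ j : Fin L, ∃ i i' : Fin n, i ≠ i' ∧ χ (u (i, j)) = χ (u (i', j)) := by
      intro j
      exact Fintype.exists_ne_map_eq_of_card_lt (fun i => χ (u (i, j))) (by simp [hn])
    choose i i' hii hχ using hcol
    obtain ⟨⟨a, b, c⟩, hlab⟩ := Fintype.exists_lt_card_fiber_of_mul_lt_card (n := g)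
      (fun j : Fin L => ((i j, i' j, χ (u (i j, j))) : Fin n × Fin n × C)) (by
        rw [Fintype.card_fin, hL]; exact Nat.lt_succ_self _)
    set F := Finset.univ.filter (fun j : Fin L => (i j, i' j, χ (u (i j, j))) = (a, b, c)) with hF
    have hFm : ∀ j ∈ F, i j = a ∧ i' j = b ∧ χ (u (i j, j)) = c := by
      intro j hj
      simpa [hF] using hj
    obtain ⟨j0, hj0⟩ : F.Nonempty := Finset.card_pos.1 (by omega)
    have hab : a ≠ b := by
      obtain ⟨h1, h1', h1''⟩ := hFm j0 hj0
      rw [← h1, ← h1']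
      exact hii j0
    refine ⟨{z | ∃ j ∈ F, z = u (a, j) ∨ z = u (b, j)}, ?_, c, ?_, ?_⟩
    · rintro z ⟨j, _, rfl | rfl⟩ <;> exact ⟨_, rfl⟩
    · rintro z ⟨j, hj, hz⟩
      obtain ⟨h1, h1', h1''⟩ := hFm j hj
      have h2 := hχ j
      rw [h1, h1'] at h2
      rw [h1] at h1''
      rcases hz with rfl | rfl
      · exact h1''
      · exact h2.symm.trans h1''
    · intro hB
      have := hB (u (a, j0) - u (b, j0)) (by
        rw [sub_ne_zero]; intro h; exact hab (Prod.ext_iff.1 (inj h)).1)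
      have hle : ((F : Set (Fin L)).encard) ≤ g := by
        refine le_trans ?_ this
        refine Set.encard_le_encard_of_injOn (f := fun j => (u (a, j), u (b, j))) ?_ ?_
        · intro j hj
          refine ⟨⟨j, hj, Or.inl rfl⟩, ⟨j, hj, Or.inr rfl⟩, ?_⟩
          have : u (a, j) + u (b, j0) = u (a, j0) + u (b, j) := by
            rw [hu]; simp only [x]; abel
          simp only
          linarith
        · intro j _ j' _ h
          exact (Prod.ext_iff.1 (inj (Prod.ext_iff.1 h).1)).2
      rw [Set.encard_coe_eq_coe_finsetCard] at hle
      have : F.card ≤ g := by exact_mod_cast hle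
      omega

/-- edges of the complete graph on `Fin n`. -/
abbrev VEdge (n : ℕ) : Type := {θ : Fin n × Fin n // θ.1 < θ.2}

/-- `h` is opposite at the two ends of `θ`. -/
def VGood {n : ℕ} (h : Fin n → SignType) (θ : VEdge n) : Prop :=
  (h θ.1.1 : ℤ) + (h θ.1.2 : ℤ) = 0

/-- index of coordinates -/
abbrev VIdx (n Q : ℕ) : Type :=
  Fin n ⊕ ((Fin n → SignType) × VEdge n × VEdge n × Fin Q × Fin Q)

open Classical in
/-- the free configuration -/
noncomputable def vx {n Q : ℕ} (a : Fin n × (VEdge n → Fin Q)) : VIdx n Q → ℤ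
  | Sum.inl t => if a.1 = t then 1 else 0
  | Sum.inr (h, θ₁, θ₂, r, s) =>
      if VGood h θ₁ ∧ VGood h θ₂ then
        (h a.1 : ℤ) * (if a.2 θ₁ = r ∧ a.2 θ₂ = s then 1 else 0) else 0

lemma good_exists₁ {n : ℕ} (τ σ : Fin n) (hne : τ ≠ σ) (θ : VEdge n)
    (h1 : θ.1 ≠ (τ, σ)) (h2 : θ.1 ≠ (σ, τ)) :
    ∃ h : Fin n → SignType, h τ = 1 ∧ h σ = 0 ∧ VGood h θ := by
  obtain ⟨⟨a, b⟩, hab⟩ := θ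
  have hab' : a ≠ b := ne_of_lt hab
  refine ⟨fun v => if v = τ then 1 else if (a = τ ∧ v = b) ∨ (b = τ ∧ v = a) then -1 else 0,
    by simp, ?_, ?_⟩
  · simp only [ne_eq, Prod.mk.injEq] at h1 h2
    grind
  · simp only [VGood]
    by_cases ha : a = τ
    · subst ha; simp [hab'.symm]
    · by_cases hb : b = τ
      · subst hb; simp [hab']
      · simp [ha, hb]

lemma good_exists₂ {n : ℕ} (τ σ : Fin n) (hne : τ ≠ σ) (θ : VEdge n)
    (h1 : θ.1 = (τ, σ) ∨ θ.1 = (σ, τ)) :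
    ∃ h : Fin n → SignType, h τ = 1 ∧ h σ = -1 ∧ VGood h θ := by
  refine ⟨fun v => if v = τ then 1 else -1, by simp, by simp [hne.symm], ?_⟩
  rcases h1 with h | h <;> simp [VGood, h, hne.symm]

lemma good_exists₃ {n : ℕ} (τ : Fin n) (θ θ' : VEdge n) :
    ∃ h : Fin n → SignType, h τ = 1 ∧ VGood h θ ∧ VGood h θ' := by
  -- `A`: edges as unordered pairs
  have main : ∀ a b c d : Fin n, a ≠ b → c ≠ d →
      ∃ h : Fin n → SignType, h τ = 1 ∧ h a = - h b ∧ h c = - h d := by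
    have one : ∀ b c d : Fin n, τ ≠ b → c ≠ d →
      ∃ h : Fin n → SignType, h τ = 1 ∧ h b = - 1 ∧ h c = - h d := by
      intro b c d hb hcd
      by_cases hc : c = τ
      · exact ⟨fun v => if v = τ then 1 else -1, by simp, by simp [hb.symm],
          by simp [hc, (hc ▸ hcd).symm]⟩
      by_cases hd : d = τ
      · exact ⟨fun v => if v = τ then 1 else -1, by simp, by simp [hb.symm],
          by simp [hd, hc]⟩
      by_cases hcb : c = b
      · subst hcb
        exact ⟨fun v => if v = τ then 1 else if v = c then -1 else 1, by simp, by simp [hc],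
          by simp [hc, hd, hcd.symm]⟩
      by_cases hdb : d = b
      · subst hdb
        exact ⟨fun v => if v = τ then 1 else if v = d then -1 else 1, by simp, by simp [hd],
          by simp [hc, hd, hcd]⟩
      · exact ⟨fun v => if v = τ then 1 else if v = b then -1 else 0, by simp, by simp [hb.symm],
          by simp [hc, hd, hcb, hdb]⟩
    intro a b c d hab hcd
    by_cases ha : a = τ
    · subst ha
      obtain ⟨h, h1, h2, h3⟩ := one b c d hab hcd
      exact ⟨h, h1, by rw [h1, h2]; rfl, h3⟩
    by_cases hb : b = τ
    · subst hb
      obtain ⟨h, h1, h2, h3⟩ := one a c d hab.symm hcd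
      exact ⟨h, h1, by rw [h1, h2], h3⟩
    by_cases hc : c = τ
    · subst hc
      obtain ⟨h, h1, h2, h3⟩ := one d a b hcd hab
      exact ⟨h, h1, h3, by rw [h1, h2]; rfl⟩
    by_cases hd : d = τ
    · subst hd
      obtain ⟨h, h1, h2, h3⟩ := one c a b hcd.symm hab
      exact ⟨h, h1, h3, by rw [h1, h2]⟩
    exact ⟨fun v => if v = τ then 1 else 0, by simp, by simp [ha, hb], by simp [hc, hd]⟩
  obtain ⟨h, h1, h2, h3⟩ := main _ _ _ _ (ne_of_lt θ.2) (ne_of_lt θ'.2)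
  refine ⟨h, h1, ?_, ?_⟩
  · simp only [VGood]; rw [h2]; generalize h _ = s; cases s <;> simp
  · simp only [VGood]; rw [h3]; generalize h _ = s; cases s <;> simp

open Classical in
/-- coordinates of an additive relation. -/
lemma vx_coord {n Q : ℕ} {a b c d : Fin n × (VEdge n → Fin Q)} (E : vx a + vx d = vx c + vx b)
    (h : Fin n → SignType) (θ θ' : VEdge n) (h1 : VGood h θ) (h2 : VGood h θ') (r s : Fin Q) :
    (h a.1 : ℤ) * (if a.2 θ = r ∧ a.2 θ' = s then 1 else 0) +
    (h d.1 : ℤ) * (if d.2 θ = r ∧ d.2 θ' = s then 1 else 0) =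
    (h c.1 : ℤ) * (if c.2 θ = r ∧ c.2 θ' = s then 1 else 0) +
    (h b.1 : ℤ) * (if b.2 θ = r ∧ b.2 θ' = s then 1 else 0) := by
  have := congrFun E (Sum.inr (h, θ, θ', r, s))
  simpa only [Pi.add_apply, vx, h1, h2, and_self, if_true] using this

lemma vx_types {n Q : ℕ} {a b c d : Fin n × (VEdge n → Fin Q)} (E : vx a + vx d = vx c + vx b) :
    (a.1 = c.1 ∧ b.1 = d.1) ∨ (a.1 = b.1 ∧ c.1 = d.1) := by
  have h1 := congrFun E (Sum.inl a.1)
  have h2 := congrFun E (Sum.inl d.1)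
  simp only [Pi.add_apply, vx] at h1 h2
  grind

lemma vx_injective {n Q : ℕ} : Function.Injective (vx : Fin n × (VEdge n → Fin Q) → _) := by
  rintro ⟨τ, p⟩ ⟨σ, q⟩ hE
  have E : vx (τ, p) + vx (τ, p) = vx (σ, q) + vx (σ, q) := by rw [hE]
  have ht := vx_types E
  simp only [and_self] at ht
  have hts : τ = σ := by tauto
  subst hts
  refine Prod.ext rfl (funext fun θ => ?_)
  obtain ⟨h, h1, h2, -⟩ := good_exists₃ τ θ θ
  have := vx_coord E h θ θ h2 h2 (p θ) (p θ)
  simp [h1] at this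
  grind

/-- differences between different types -/
lemma vx_diff {n Q : ℕ} {τ σ : Fin n} (hne : τ ≠ σ) {p q p' q' : VEdge n → Fin Q}
    (E : vx (τ, p) + vx (σ, q') = vx (τ, p') + vx (σ, q)) :
    (∀ θ : VEdge n, θ.1 ≠ (τ, σ) → θ.1 ≠ (σ, τ) → p θ = p' θ ∧ q θ = q' θ) ∧
    (∀ θ : VEdge n, (θ.1 = (τ, σ) ∨ θ.1 = (σ, τ)) →
      (p θ = p' θ ∧ q θ = q' θ) ∨ (p θ = q' θ ∧ q θ = p' θ)) := by
  constructor
  · intro θ h1 h2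
    constructor
    · obtain ⟨h, a1, a2, a3⟩ := good_exists₁ τ σ hne θ h1 h2
      have := vx_coord E h θ θ a3 a3 (p θ) (p θ)
      simp [a1, a2] at this
      grind
    · obtain ⟨h, a1, a2, a3⟩ := good_exists₁ σ τ hne.symm θ h2 h1
      have := vx_coord E h θ θ a3 a3 (q θ) (q θ)
      simp [a1, a2] at this
      grind
  · intro θ h1
    obtain ⟨h, a1, a2, a3⟩ := good_exists₂ τ σ hne θ h1
    have e1 := vx_coord E h θ θ a3 a3 (p θ) (p θ)
    have e2 := vx_coord E h θ θ a3 a3 (q θ) (q θ)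
    simp [a1, a2] at e1 e2
    grind

/-- differences inside one type -/
lemma vx_same {n Q : ℕ} {τ : Fin n} {p q p' q' : VEdge n → Fin Q} (hpq : p ≠ q)
    (E : vx (τ, p) + vx (τ, q') = vx (τ, p') + vx (τ, q)) : p = p' ∧ q = q' := by
  obtain ⟨θ₁, hθ₁⟩ := Function.ne_iff.1 hpq
  have : ∀ θ, p θ = p' θ ∧ q θ = q' θ := by
    intro θ
    obtain ⟨h, a1, a2, a3⟩ := good_exists₃ τ θ₁ θ
    have e1 := vx_coord E h θ₁ θ a2 a3 (p θ₁) (p θ)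
    have e2 := vx_coord E h θ₁ θ a2 a3 (q θ₁) (q θ)
    simp [a1] at e1 e2
    grind
  exact ⟨funext fun θ => (this θ).1, funext fun θ => (this θ).2⟩

/-- equal differences inside two types -/
lemma vx_two {n Q : ℕ} {τ σ : Fin n} (hne : τ ≠ σ) {p q p' q' : VEdge n → Fin Q}
    (E : vx (τ, p) + vx (σ, q') = vx (σ, p') + vx (τ, q)) (θ : VEdge n)
    (h1 : θ.1 ≠ (τ, σ)) (h2 : θ.1 ≠ (σ, τ)) : p θ = q θ := by
  obtain ⟨h, a1, a2, a3⟩ := good_exists₁ τ σ hne θ h1 h2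
  have := vx_coord E h θ θ a3 a3 (p θ) (p θ)
  simp [a1, a2] at this
  grind

/-- the sum relation -/
lemma vx_sum {n Q : ℕ} (θ : VEdge n) (p q : VEdge n → Fin Q) (hpq : ∀ θ', θ' ≠ θ → p θ' = q θ') :
    vx (θ.1.1, p) + vx (θ.1.2, p) = vx (θ.1.1, q) + vx (θ.1.2, q) := by
  funext i
  rcases i with t | ⟨h, θ₁, θ₂, r, s⟩
  · simp [vx]
  · simp only [Pi.add_apply, vx]
    split_ifs with hg
    all_goals try rfl
    all_goals
      by_cases h0 : VGood h θ
      · simp only [VGood] at h0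
        simp
        try linarith
      · have e1 : θ₁ ≠ θ := fun h => h0 (h ▸ hg.1)
        have e2 : θ₂ ≠ θ := fun h => h0 (h ▸ hg.2)
        have e3 := hpq _ e1
        have e4 := hpq _ e2
        grind

lemma exists_V (g : ℕ) (C : Type) [Fintype C] :
    ∃ V : Set ℤ, V.Finite ∧ IsB2Circ 2 V ∧ ∀ χ : ℤ → C, ∃ e ⊆ V, ∃ c, (∀ a ∈ e, χ a = c) ∧
      ¬ IsB2 g e := by
  classical
  obtain ⟨n, hn⟩ : ∃ n, n = Fintype.card C + 1 := ⟨_, rfl⟩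
  obtain ⟨Q, hQ⟩ : ∃ Q, Q = Fintype.card (VEdge n × C) * g + 1 := ⟨_, rfl⟩
  obtain ⟨v, hv⟩ := exists_generic (vx : Fin n × (VEdge n → Fin Q) → _)
  have inj : Function.Injective v := by
    intro a b h
    have h1 : v a + v a = v b + v a := by rw [h]
    rw [hv] at h1
    exact vx_injective (add_right_cancel h1)
  refine ⟨Set.range v, Set.finite_range v, ?_, ?_⟩
  · intro ξ hξ
    by_contra hlt
    rw [not_le] at hlt
    have h3 : (3 : ℕ∞) ≤ {p : ℤ × ℤ | p.1 ∈ Set.range v ∧ p.2 ∈ Set.range v ∧ p.1 - p.2 = ξ}.encard := by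
      have := Order.add_one_le_of_lt hlt
      have h21 : ((2 : ℕ) : ℕ∞) + 1 = 3 := by norm_num
      rwa [h21] at this
    obtain ⟨t, ht, htc⟩ := Set.exists_subset_encard_eq h3
    obtain ⟨x, y, z, hxy, hxz, hyz, rfl⟩ := Set.encard_eq_three.1 htc
    obtain ⟨⟨a, ha⟩, ⟨b, hb⟩, hab⟩ := ht (show x ∈ _ by simp)
    obtain ⟨⟨a', ha'⟩, ⟨b', hb'⟩, hab'⟩ := ht (show y ∈ _ by simp)
    obtain ⟨⟨a'', ha''⟩, ⟨b'', hb''⟩, hab''⟩ := ht (show z ∈ _ by simp)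
    have n1 : ¬ (a = a' ∧ b = b') := by
      rintro ⟨rfl, rfl⟩; exact hxy (Prod.ext (ha.symm.trans ha') (hb.symm.trans hb'))
    have n2 : ¬ (a = a'' ∧ b = b'') := by
      rintro ⟨rfl, rfl⟩; exact hxz (Prod.ext (ha.symm.trans ha'') (hb.symm.trans hb''))
    have n3 : ¬ (a' = a'' ∧ b' = b'') := by
      rintro ⟨rfl, rfl⟩; exact hyz (Prod.ext (ha'.symm.trans ha'') (hb'.symm.trans hb''))
    have E1 : vx a + vx b' = vx a' + vx b := by rw [← hv]; linarith
    have E2 : vx a + vx b'' = vx a'' + vx b := by rw [← hv]; linarith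
    have E3 : vx a' + vx b'' = vx a'' + vx b' := by rw [← hv]; linarith
    have nab : a ≠ b := by rintro rfl; apply hξ; rw [← hab, ← ha, ← hb, sub_self]
    clear hab hab' hab'' ha ha' ha'' hb hb' hb'' ht htc h3 hlt hxy hxz hyz
    have T1 := vx_types E1
    have T2 := vx_types E2
    have T3 := vx_types E3
    obtain ⟨τ, p⟩ := a
    obtain ⟨σ, q⟩ := b
    obtain ⟨τ', p'⟩ := a'
    obtain ⟨σ', q'⟩ := b'
    obtain ⟨τ'', p''⟩ := a''
    obtain ⟨σ'', q''⟩ := b''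
    simp only [Prod.mk.injEq] at *
    by_cases hτσ : τ = σ
    · subst hτσ
      have e1 : τ' = σ' := by rcases T1 with h | h <;> [exact h.1.symm.trans h.2; exact h.2]
      have e2 : τ'' = σ'' := by rcases T2 with h | h <;> [exact h.1.symm.trans h.2; exact h.2]
      subst e1 e2
      have npq : p ≠ q := by rintro rfl; exact nab rfl
      have d1 : τ ≠ τ' := by
        rintro rfl
        obtain ⟨h1, h2⟩ := vx_same npq E1
        exact n1 ⟨⟨rfl, h1⟩, rfl, h2⟩
      have d2 : τ ≠ τ'' := by
        rintro rfl
        obtain ⟨h1, h2⟩ := vx_same npq E2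
        exact n2 ⟨⟨rfl, h1⟩, rfl, h2⟩
      have npq' : p' ≠ q' := by
        rintro rfl
        rw [add_comm] at E1
        exact npq (Prod.ext_iff.1 (vx_injective (add_left_cancel E1))).2
      have d3 : τ' ≠ τ'' := by
        rintro rfl
        obtain ⟨h1, h2⟩ := vx_same npq' E3
        exact n3 ⟨⟨rfl, h1⟩, rfl, h2⟩
      apply npq
      funext θ
      by_cases hθ : θ.1 ≠ (τ, τ') ∧ θ.1 ≠ (τ', τ)
      · exact vx_two d1 E1 θ hθ.1 hθ.2
      · refine vx_two d2 E2 θ ?_ ?_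
        · intro h; apply hθ; rw [h]; simp only [ne_eq, Prod.mk.injEq]; grind
        · intro h; apply hθ; rw [h]; simp only [ne_eq, Prod.mk.injEq]; grind
    · have e1 : τ = τ' ∧ σ = σ' := by tauto
      have e2 : τ = τ'' ∧ σ = σ'' := by tauto
      obtain ⟨rfl, rfl⟩ := e1
      obtain ⟨rfl, rfl⟩ := e2
      obtain ⟨a1, b1⟩ := vx_diff hτσ E1
      obtain ⟨a2, b2⟩ := vx_diff hτσ E2
      obtain ⟨θ, hθ⟩ : ∃ θ : VEdge n, θ.1 = (τ, σ) ∨ θ.1 = (σ, τ) := by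
        rcases lt_or_gt_of_ne hτσ with h | h
        · exact ⟨⟨(τ, σ), h⟩, Or.inl rfl⟩
        · exact ⟨⟨(σ, τ), h⟩, Or.inr rfl⟩
      have uniq : ∀ θ' : VEdge n, θ' ≠ θ → θ'.1 ≠ (τ, σ) ∧ θ'.1 ≠ (σ, τ) := by
        intro θ' hne
        have l1 := θ.2
        have l2 := θ'.2
        have : θ'.1 ≠ θ.1 := fun h => hne (Subtype.ext h)
        rcases hθ with h | h
        · rw [h] at this l1
          refine ⟨this, fun h' => ?_⟩
          rw [h'] at l2
          exact lt_asymm l1 l2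
        · rw [h] at this l1
          refine ⟨fun h' => ?_, this⟩
          rw [h'] at l2
          exact lt_asymm l1 l2
      have full : ∀ r r' : VEdge n → Fin Q, r θ = r' θ → (∀ θ', θ' ≠ θ → r θ' = r' θ') → r = r' := by
        intro r r' h1 h2
        funext θ'
        by_cases h : θ' = θ
        · rw [h, h1]
        · exact h2 _ h
      have o1 : ∀ θ', θ' ≠ θ → p θ' = p' θ' ∧ q θ' = q' θ' :=
        fun θ' h => a1 θ' (uniq θ' h).1 (uniq θ' h).2
      have o2 : ∀ θ', θ' ≠ θ → p θ' = p'' θ' ∧ q θ' = q'' θ' :=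
        fun θ' h => a2 θ' (uniq θ' h).1 (uniq θ' h).2
      rcases b1 θ hθ with h | h
      · exact n1 ⟨⟨rfl, full _ _ h.1 fun θ' h' => (o1 θ' h').1⟩,
          rfl, full _ _ h.2 fun θ' h' => (o1 θ' h').2⟩
      rcases b2 θ hθ with k | k
      · exact n2 ⟨⟨rfl, full _ _ k.1 fun θ' h' => (o2 θ' h').1⟩,
          rfl, full _ _ k.2 fun θ' h' => (o2 θ' h').2⟩
      · exact n3 ⟨⟨rfl, full _ _ (h.2.symm.trans k.2) fun θ' h' => (o1 θ' h').1.symm.trans (o2 θ' h').1⟩,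
          rfl, full _ _ (h.1.symm.trans k.1) fun θ' h' => (o1 θ' h').2.symm.trans (o2 θ' h').2⟩
  · intro χ
    have hcol : ∀ p : VEdge n → Fin Q, ∃ θ : VEdge n, χ (v (θ.1.1, p)) = χ (v (θ.1.2, p)) := by
      intro p
      obtain ⟨i, i', hne, h⟩ := Fintype.exists_ne_map_eq_of_card_lt
        (fun i : Fin n => χ (v (i, p))) (by simp [hn])
      rcases lt_or_gt_of_ne hne with hl | hl
      · exact ⟨⟨(i, i'), hl⟩, h⟩
      · exact ⟨⟨(i', i), hl⟩, h.symm⟩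
    choose θ hθ using hcol
    have hQ0 : 0 < Q := by omega
    have hEpos : 0 < Fintype.card (VEdge n) :=
      Fintype.card_pos_iff.2 ⟨θ (fun _ => ⟨0, hQ0⟩)⟩
    let Lab : Type := (l : VEdge n × C) × ({θ' : VEdge n // θ' ≠ l.1} → Fin Q)
    have hcard : Fintype.card Lab * g < Fintype.card (VEdge n → Fin Q) := by
      have h1 : ∀ l : VEdge n × C, Fintype.card ({θ' : VEdge n // θ' ≠ l.1} → Fin Q)
          = Q ^ (Fintype.card (VEdge n) - 1) := by
        intro l
        rw [Fintype.card_fun, Fintype.card_fin]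
        congr 1
        rw [Fintype.card_subtype_compl, Fintype.card_subtype_eq]
      have h2 : Fintype.card Lab = Fintype.card (VEdge n × C) * Q ^ (Fintype.card (VEdge n) - 1) := by
        rw [Fintype.card_sigma, Finset.sum_congr rfl (fun l _ => h1 l)]
        simp
      rw [h2, Fintype.card_fun, Fintype.card_fin]
      obtain ⟨N, hN⟩ : ∃ N, Fintype.card (VEdge n) = N + 1 := ⟨_, (Nat.succ_pred_eq_of_pos hEpos).symm⟩
      rw [hN, Nat.add_sub_cancel, pow_succ]
      have : 0 < Q ^ N := pow_pos hQ0 N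
      calc Fintype.card (VEdge n × C) * Q ^ N * g
          = Q ^ N * (Fintype.card (VEdge n × C) * g) := by ring
        _ < Q ^ N * Q := by
          apply Nat.mul_lt_mul_of_pos_left _ this
          omega
    let lab : (VEdge n → Fin Q) → Lab := fun p =>
      ⟨(θ p, χ (v ((θ p).1.1, p))), fun θ' => p θ'.1⟩
    obtain ⟨⟨⟨θ₀, c⟩, r⟩, hlab⟩ := Fintype.exists_lt_card_fiber_of_mul_lt_card (n := g) lab hcard
    set F := Finset.univ.filter (fun p => lab p = ⟨(θ₀, c), r⟩) with hF
    have hFm : ∀ p ∈ F, θ p = θ₀ ∧ χ (v ((θ p).1.1, p)) = c ∧ ∀ θ' (h : θ' ≠ θ₀), p θ' = r ⟨θ', h⟩ := by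
      intro p hp
      have hp' : lab p = ⟨(θ₀, c), r⟩ := (Finset.mem_filter.1 hp).2
      simp only [lab] at hp'
      obtain ⟨h1, h2⟩ := Sigma.mk.inj_iff.1 hp'
      obtain ⟨rfl, rfl⟩ := Prod.mk.inj h1
      refine ⟨rfl, rfl, fun θ' h => ?_⟩
      exact congrFun (eq_of_heq h2) ⟨θ', h⟩
    obtain ⟨p0, hp0⟩ : F.Nonempty := Finset.card_pos.1 (by omega)
    refine ⟨{z | ∃ p ∈ F, z = v (θ₀.1.1, p) ∨ z = v (θ₀.1.2, p)}, ?_, c, ?_, ?_⟩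
    · rintro z ⟨j, _, rfl | rfl⟩ <;> exact ⟨_, rfl⟩
    · rintro z ⟨p, hp, hz⟩
      obtain ⟨h1, h2, -⟩ := hFm p hp
      have h3 := hθ p
      rw [h1] at h2 h3
      rcases hz with rfl | rfl
      · exact h2
      · exact h3.symm.trans h2
    · intro hB
      have := hB (v (θ₀.1.1, p0) + v (θ₀.1.2, p0))
      have hle : ((F : Set (VEdge n → Fin Q)).encard) ≤ g := by
        refine le_trans ?_ this
        refine Set.encard_le_encard_of_injOn
          (f := fun p => s(v (θ₀.1.1, p), v (θ₀.1.2, p))) ?_ ?_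
        · intro p hp
          refine ⟨_, ⟨p, hp, Or.inl rfl⟩, _, ⟨p, hp, Or.inr rfl⟩, rfl, ?_⟩
          rw [hv]
          apply vx_sum
          intro θ' h
          rw [(hFm p hp).2.2 θ' h, (hFm p0 hp0).2.2 θ' h]
        · intro p _ p' _ h
          rcases Sym2.eq_iff.1 h with h | h
          · exact (Prod.ext_iff.1 (inj h.1)).2
          · exact absurd (Prod.ext_iff.1 (inj h.1)).1 (ne_of_lt θ₀.2)
      rw [Set.encard_coe_eq_coe_finsetCard] at hle
      have : F.card ≤ g := by exact_mod_cast hle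
      omega

lemma isB2_of_row {g : ℕ} {T : Set (ℤ × ℤ)} {f : Set ℤ} {u : ℤ} (hT : IsB2 g T)
    (h : ∀ b ∈ f, (u, b) ∈ T) : IsB2 g f := by
  intro ξ
  refine le_trans ?_ (hT (u + u, ξ))
  have hinj : Function.Injective (fun b : ℤ => (u, b)) := fun a b h => (Prod.ext_iff.1 h).2
  refine Set.encard_le_encard_of_injOn (f := Sym2.map (fun b => (u, b))) ?_
    (Sym2.map.injective hinj).injOn
  rintro p ⟨a, ha, b, hb, rfl, hs⟩
  exact ⟨(u, a), h a ha, (u, b), h b hb, rfl, by simp [hs]⟩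

lemma isB2Circ_of_col {g : ℕ} {T : Set (ℤ × ℤ)} {e : Set ℤ} {v : ℤ} (hT : IsB2Circ g T)
    (h : ∀ a ∈ e, (a, v) ∈ T) : IsB2Circ g e := by
  intro ξ hξ
  refine le_trans ?_ (hT (ξ, 0) (by simp [hξ]))
  refine Set.encard_le_encard_of_injOn (f := fun p : ℤ × ℤ => ((p.1, v), (p.2, v))) ?_ ?_
  · rintro p ⟨h1, h2, h3⟩
    exact ⟨h _ h1, h _ h2, by simp [h3]⟩
  · rintro p _ q _ hpq
    simp only [Prod.mk.injEq, and_true] at hpq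
    exact Prod.ext hpq.1 hpq.2

lemma final_step (hU : ∀ (g : ℕ) (C : Type) [Fintype C],
    ∃ U : Set ℤ, U.Finite ∧ IsB2 2 U ∧ ∀ χ : ℤ → C, ∃ e ⊆ U, ∃ c, (∀ a ∈ e, χ a = c) ∧
      ¬ IsB2Circ g e) (hV : ∀ (g : ℕ) (C : Type) [Fintype C],
    ∃ V : Set ℤ, V.Finite ∧ IsB2Circ 2 V ∧ ∀ χ : ℤ → C, ∃ e ⊆ V, ∃ c, (∀ a ∈ e, χ a = c) ∧
      ¬ IsB2 g e) : ∀ g k : ℕ, 0 < g → 5 ≤ k →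
      ∃ U V : Set ℤ,
        U.Finite ∧ V.Finite ∧ IsB2 2 U ∧ IsB2Circ 2 V ∧
        ∀ m : ℕ, 0 < m → (m : ℝ) ≤ (k : ℝ) / 3 - 1 →
          ¬ ∃ T : Fin m → Set (ℤ × ℤ),
              (∀ i, IsB2 g (T i) ∨ IsB2Circ g (T i)) ∧ U ×ˢ V = ⋃ i, T i := by
  classical
  intro g k hg hk
  obtain ⟨U, hUf, hUB, hUχ⟩ := hU g (Fin k)
  have : Finite U := hUf
  have : Finite (Set U) := inferInstance
  letI : Fintype (Set U × Fin k) := Fintype.ofFinite _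
  obtain ⟨V, hVf, hVB, hVχ⟩ := hV g (Set U × Fin k)
  refine ⟨U, V, hUf, hVf, hUB, hVB, ?_⟩
  rintro m hm hmk ⟨T, hT, hUV⟩
  have hmk' : m ≤ k := by
    have : (m : ℝ) ≤ k := by
      have : (0 : ℝ) ≤ k := Nat.cast_nonneg k
      linarith
    exact_mod_cast this
  have hcov : ∀ u v : ℤ, ∃ i : Fin m, u ∈ U → v ∈ V → (u, v) ∈ T i := by
    intro u v
    by_cases h : u ∈ U ∧ v ∈ V
    · have : (u, v) ∈ ⋃ i, T i := by rw [← hUV]; exact h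
      obtain ⟨i, hi⟩ := Set.mem_iUnion.1 this
      exact ⟨i, fun _ _ => hi⟩
    · exact ⟨⟨0, hm⟩, fun h1 h2 => absurd ⟨h1, h2⟩ h⟩
  choose χ hχ using hcov
  choose e he c hc hbad using fun v => hUχ (fun u => Fin.castLE hmk' (χ u v))
  obtain ⟨f, hfV, ⟨E, c0⟩, hmono, hfbad⟩ :=
    hVχ (fun v => ((Subtype.val ⁻¹' e v : Set U), c v))
  have hfne : f.Nonempty := by
    by_contra h
    rw [Set.not_nonempty_iff_eq_empty] at h
    apply hfbad
    intro ξ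
    simp [h]
  obtain ⟨v0, hv0⟩ := hfne
  have hEq : ∀ v ∈ f, e v = e v0 := by
    intro v hv
    have h1 := (Prod.ext_iff.1 (hmono v hv)).1
    have h2 := (Prod.ext_iff.1 (hmono v0 hv0)).1
    have h3 := h1.trans h2.symm
    ext z
    constructor
    · intro hz
      exact (Set.ext_iff.1 h3 ⟨z, he v hz⟩).1 hz
    · intro hz
      exact (Set.ext_iff.1 h3 ⟨z, he v0 hz⟩).2 hz
  have hcEq : ∀ v ∈ f, c v = c0 := fun v hv => (Prod.ext_iff.1 (hmono v hv)).2
  have hene : (e v0).Nonempty := by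
    by_contra h
    rw [Set.not_nonempty_iff_eq_empty] at h
    apply hbad v0
    intro ξ _
    simp [h]
  obtain ⟨u0, hu0⟩ := hene
  have hall : ∀ u ∈ e v0, ∀ v ∈ f, (u, v) ∈ T (χ u0 v0) := by
    intro u hu v hv
    have h1 : Fin.castLE hmk' (χ u v) = c0 := by
      rw [← hcEq v hv]; exact hc v u (by rw [hEq v hv]; exact hu)
    have h2 : Fin.castLE hmk' (χ u0 v0) = c0 := by
      rw [← hcEq v0 hv0]; exact hc v0 u0 hu0
    have h3 : χ u v = χ u0 v0 := Fin.castLE_injective hmk' (h1.trans h2.symm)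
    rw [← h3]
    exact hχ u v (he v0 hu) (hfV hv)
  rcases hT (χ u0 v0) with h | h
  · exact hfbad (isB2_of_row h (fun b hb => hall u0 hu0 b hb))
  · exact hbad v0 (isB2Circ_of_col h (fun a ha => hall a ha v0 hv0))

theorem stmt_8 :
    ∀ g k : ℕ, 0 < g → 5 ≤ k →
      ∃ U V : Set ℤ,
        U.Finite ∧ V.Finite ∧ IsB2 2 U ∧ IsB2Circ 2 V ∧
        ∀ m : ℕ, 0 < m → (m : ℝ) ≤ (k : ℝ) / 3 - 1 →
          ¬ ∃ T : Fin m → Set (ℤ × ℤ),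
              (∀ i, IsB2 g (T i) ∨ IsB2Circ g (T i)) ∧ U ×ˢ V = ⋃ i, T i := by
  exact final_step exists_U exists_V
end

section
/- There exists a real constant δ > 0 such that for every positive integer g and every real δ' > 0, there exists a nonempty finite set A ⊆ ℤ² with the following properties: (i) for every subset A' ⊆ A, |A' + A'| ≥ δ·|A'|² and |A' − A'| ≥ δ·|A'|²; and (ii) no subset A'' ⊆ A with |A''| ≥ δ'·|A| is a B₂[g] set or a B₂°[g] set. -/
open scoped Pointwise

namespace S9
open Finset

/-- Union bound: a random `f` avoids all the prescribed concentrations. -/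
lemma exist_f {V ι : Type} [Fintype V] [DecidableEq V] [Fintype ι] (Q N C : ℕ) (hQ : 0 < Q)
    (D : ι → Finset V) (π : ι → V → V) (σ v : ι → ℤ)
    (hπ : ∀ j, ∀ b ∈ D j, π j b ∉ D j) (hD : ∀ j, (D j).card ≤ N)
    (hlt : Fintype.card ι * N ^ C < Q ^ C) :
    ∃ f : V → Fin Q, ∀ j,
      ((D j).filter (fun b => ((f b : ℕ) : ℤ) + σ j * ((f (π j b) : ℕ) : ℤ) = v j)).card < C := by
  classical
  by_contra hcon
  push Not at hcon
  let B : ι → Finset V → Finset (V → Fin Q) := fun j T =>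
    univ.filter (fun f => ∀ b ∈ T, ((f b : ℕ) : ℤ) + σ j * ((f (π j b) : ℕ) : ℤ) = v j)
  have hcover : (univ : Finset (V → Fin Q)) ⊆
      univ.biUnion (fun j => ((D j).powersetCard C).biUnion (fun T => B j T)) := by
    intro f _
    obtain ⟨j, hj⟩ := hcon f
    obtain ⟨T, hT, hTc⟩ := exists_subset_card_eq hj
    simp only [mem_biUnion, mem_univ, true_and, mem_powersetCard]
    refine ⟨j, T, ⟨hT.trans (filter_subset _ _), hTc⟩, ?_⟩
    simp only [B, mem_filter, mem_univ, true_and]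
    intro b hb
    exact (mem_filter.1 (hT hb)).2
  have hB : ∀ j, ∀ T ∈ (D j).powersetCard C, (B j T).card * Q ^ C ≤ Q ^ Fintype.card V := by
    intro j T hT
    rw [mem_powersetCard] at hT
    have h1 : (B j T).card * Q ^ C = (B j T ×ˢ (univ : Finset (T → Fin Q))).card := by
      rw [card_product, card_univ, Fintype.card_fun, Fintype.card_fin, Fintype.card_coe, hT.2]
    have h2 : Q ^ Fintype.card V = (univ : Finset (V → Fin Q)).card := by
      rw [card_univ, Fintype.card_fun, Fintype.card_fin]
    rw [h1, h2]
    refine card_le_card_of_injOn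
      (fun p => fun b => if hb : b ∈ T then p.2 ⟨b, hb⟩ else p.1 b) (fun _ _ => mem_coe.2 (mem_univ _)) ?_
    rintro ⟨f, h⟩ hf ⟨f', h'⟩ hf' heq
    simp only [coe_product, Set.mem_prod, mem_coe, B, mem_filter, mem_univ, true_and, and_true] at hf hf'
    have hoff : ∀ b, b ∉ T → f b = f' b := by
      intro b hb
      have := congrFun heq b
      simpa [hb] using this
    have hon : ∀ b, b ∈ T → f b = f' b := by
      intro b hb
      have e1 := hf b hb
      have e2 := hf' b hb
      have hnot : π j b ∉ T := fun hh => hπ j b (hT.1 hb) (hT.1 hh)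
      rw [hoff _ hnot] at e1
      apply Fin.ext
      have : ((f b : ℕ) : ℤ) = ((f' b : ℕ) : ℤ) := by linarith
      exact_mod_cast this
    have e1 : f = f' := by
      funext b
      by_cases hb : b ∈ T
      · exact hon b hb
      · exact hoff b hb
    have e2 : h = h' := by
      funext ⟨b, hb⟩
      have := congrFun heq b
      simpa [hb] using this
    rw [e1, e2]
  have hcard : Q ^ Fintype.card V ≤ ∑ j : ι, ∑ T ∈ (D j).powersetCard C, (B j T).card := by
    have := card_le_card hcover
    rw [card_univ, Fintype.card_fun, Fintype.card_fin] at this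
    refine this.trans (card_biUnion_le.trans (sum_le_sum fun j _ => card_biUnion_le))
  have h3 : Q ^ Fintype.card V * Q ^ C ≤ (Fintype.card ι * N ^ C) * Q ^ Fintype.card V := by
    calc Q ^ Fintype.card V * Q ^ C
        ≤ (∑ j : ι, ∑ T ∈ (D j).powersetCard C, (B j T).card) * Q ^ C := Nat.mul_le_mul_right _ hcard
      _ = ∑ j : ι, ∑ T ∈ (D j).powersetCard C, (B j T).card * Q ^ C := by
          simp_rw [sum_mul]
      _ ≤ ∑ j : ι, ∑ T ∈ (D j).powersetCard C, Q ^ Fintype.card V :=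
          sum_le_sum fun j _ => sum_le_sum fun T hT => hB j T hT
      _ = ∑ j : ι, (D j).card.choose C * Q ^ Fintype.card V := by simp
      _ ≤ ∑ j : ι, N ^ C * Q ^ Fintype.card V := by
          refine sum_le_sum fun j _ => Nat.mul_le_mul_right _ ?_
          exact (Nat.choose_le_pow _ _).trans (Nat.pow_le_pow_left (hD j) _)
      _ = _ := by simp [mul_assoc]
  have h4 : (Fintype.card ι * N ^ C) * Q ^ Fintype.card V < Q ^ C * Q ^ Fintype.card V :=
    Nat.mul_lt_mul_of_pos_right hlt (pow_pos hQ _)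
  rw [mul_comm (Q ^ C)] at h4
  omega

lemma sum_cons {n : ℕ} (g : (Fin (n + 1) → Bool) → ℝ) :
    ∑ x, g x = ∑ x, g (Fin.cons true x) + ∑ x, g (Fin.cons false x) := by
  rw [← (Fin.consEquiv (fun _ => Bool)).sum_comp, Fintype.sum_prod_type]
  simp [Fin.consEquiv]

lemma hd_cons {n : ℕ} (a b : Bool) (x y : Fin n → Bool) :
    hammingDist (Fin.cons a x : Fin (n + 1) → Bool) (Fin.cons b y) =
      (if a ≠ b then 1 else 0) + hammingDist x y := by
  simp only [hammingDist, card_filter, Fin.sum_univ_succ, Fin.cons_zero, Fin.cons_succ]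

lemma sum_pow_dist (y : ℝ) : ∀ (n : ℕ) (z : Fin n → Bool),
    ∑ b, y ^ hammingDist z b = (1 + y) ^ n := by
  intro n
  induction n with
  | zero => intro z; simp [hammingDist]
  | succ n ih =>
    intro z
    rw [sum_cons, ← Fin.cons_self_tail z]
    simp only [hd_cons, pow_add, ← mul_sum, ih]
    cases z 0 <;> simp <;> ring

lemma ball_le (n r : ℕ) (z : Fin n → Bool) (y : ℝ) (hy : 0 < y) (hy1 : y ≤ 1) :
    ((univ.filter (fun b => hammingDist z b ≤ r)).card : ℝ) * y ^ r ≤ (1 + y) ^ n := by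
  rw [← sum_pow_dist y n z, ← nsmul_eq_mul, ← sum_const]
  refine (sum_le_sum (g := fun b => y ^ hammingDist z b) ?_).trans
    (sum_le_sum_of_subset_of_nonneg (filter_subset _ _) (fun _ _ _ => by positivity))
  intro b hb
  exact pow_le_pow_of_le_one hy.le hy1 (mem_filter.1 hb).2

lemma ball1 (k : ℕ) (z : Fin (100 * k) → Bool) :
    (univ.filter (fun b => hammingDist z b ≤ 20 * k)).card ≤ 2 ^ (80 * k) := by
  have h := ball_le (100 * k) (20 * k) z (1 / 4) (by norm_num) (by norm_num)
  have h2 : ((univ.filter (fun b => hammingDist z b ≤ 20 * k)).card : ℝ) ≤ 2 ^ (80 * k) := by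
    have h3 : (1 + 1 / 4 : ℝ) ^ (100 * k) ≤ 2 ^ (80 * k) * (1 / 4) ^ (20 * k) := by
      rw [pow_mul, pow_mul, pow_mul, ← mul_pow]
      exact pow_le_pow_left₀ (by norm_num) (by norm_num) _
    exact le_of_mul_le_mul_right (h.trans h3) (by positivity)
  exact_mod_cast h2

lemma ball2 (k : ℕ) (z : Fin (100 * k) → Bool) :
    (univ.filter (fun b => hammingDist z b ≤ k)).card ≤ 271 ^ k := by
  have h := ball_le (100 * k) k z (1 / 100) (by norm_num) (by norm_num)
  have h2 : ((univ.filter (fun b => hammingDist z b ≤ k)).card : ℝ) ≤ 271 ^ k := by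
    have h3 : (1 + 1 / 100 : ℝ) ^ (100 * k) ≤ 271 ^ k * (1 / 100) ^ k := by
      rw [pow_mul, ← mul_pow]
      exact pow_le_pow_left₀ (by norm_num) (by norm_num) _
    exact le_of_mul_le_mul_right (h.trans h3) (by positivity)
  exact_mod_cast h2

/-- the real inequality behind the isoperimetric induction -/
lemma iso_aux (L M S T a b : ℝ) (hL : 1 ≤ L) (hM : 0 ≤ M) (ha : 0 ≤ a) (hb : 0 ≤ b)
    (hab : b ≤ a) (h1 : S * a ≤ M) (h2 : T * b ≤ M)
    (h3 : T * a ≤ L * M) : (S + T) * (a + b) ≤ (2 + L + 1 / L) * M := by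
  have hL0 : 0 < L := by linarith
  rcases eq_or_lt_of_le ha with rfl | ha'
  · have : b = 0 := le_antisymm hab hb
    subst this
    simp only [add_zero, mul_zero]
    positivity
  have hS : S ≤ M / a := by rwa [le_div_iff₀ ha']
  have hT : T ≤ L * M / a := by rwa [le_div_iff₀ ha']
  rcases le_total (L * b) a with h | h
  · have hb' : b ≤ a / L := by rw [le_div_iff₀ hL0]; linarith
    calc (S + T) * (a + b) ≤ (M / a + L * M / a) * (a + b) := by gcongr
      _ ≤ (M / a + L * M / a) * (a + a / L) := by gcongr
      _ = (2 + L + 1 / L) * M := by field_simp; ring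
  · have hb' : 0 < b := by
      rcases eq_or_lt_of_le hb with rfl | hb'
      · simp at h; linarith
      · exact hb'
    have hT' : T ≤ M / b := by rwa [le_div_iff₀ hb']
    have key : a / b + b / a ≤ L + 1 / L := by
      rw [div_add_div _ _ hb'.ne' ha'.ne', div_le_iff₀ (by positivity)]
      have : L + 1 / L = (L ^ 2 + 1) / L := by field_simp
      rw [this, div_mul_eq_mul_div, le_div_iff₀ hL0]
      have : 0 ≤ (L * b - a) * (L * a - b) := by
        apply mul_nonneg (by linarith)
        nlinarith
      nlinarith
    calc (S + T) * (a + b) ≤ (M / a + M / b) * (a + b) := by gcongr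
      _ = (2 + (a / b + b / a)) * M := by field_simp; ring
      _ ≤ (2 + (L + 1 / L)) * M := by gcongr
      _ = _ := by ring

lemma iso (L : ℝ) (hL : 1 ≤ L) : ∀ (n : ℕ) (A : (Fin n → Bool) → Prop) [DecidablePred A]
    (h : (Fin n → Bool) → ℕ), (∀ x a, A a → h x ≤ hammingDist x a) →
    (∑ x, L ^ h x) * (∑ x, if A x then (1 : ℝ) else 0) ≤ (2 + L + 1 / L) ^ n := by
  have hL0 : 0 < L := by linarith
  intro n
  induction n with
  | zero =>
    intro A _ h hA
    simp only [univ_unique, sum_singleton, pow_zero]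
    split_ifs with hh
    · have := (fun a ha => hA a a ha) _ hh
      rw [hammingDist_self, Nat.le_zero] at this
      rw [this]
      simp
    · simp
  | succ n ih =>
    intro A _ h hA
    have same : ∀ c : Bool, (∑ x, L ^ h (Fin.cons c x)) *
        (∑ x, if A (Fin.cons c x) then (1 : ℝ) else 0) ≤ (2 + L + 1 / L) ^ n := by
      intro c
      refine ih (fun x => A (Fin.cons c x)) (fun x => h (Fin.cons c x)) ?_
      intro x a ha
      have := hA (Fin.cons c x) _ ha
      simpa [hd_cons] using this
    have diff : ∀ c d : Bool, c ≠ d → (∑ x, L ^ h (Fin.cons c x)) *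
        (∑ x, if A (Fin.cons d x) then (1 : ℝ) else 0) ≤ L * (2 + L + 1 / L) ^ n := by
      intro c d hcd
      have := ih (fun x => A (Fin.cons d x)) (fun x => h (Fin.cons c x) - 1) ?_
      · refine le_trans ?_ (mul_le_mul_of_nonneg_left this hL0.le)
        rw [← mul_assoc]
        refine mul_le_mul_of_nonneg_right ?_
          (sum_nonneg fun x _ => by split_ifs <;> norm_num)
        rw [mul_sum]
        refine sum_le_sum fun x _ => ?_
        rw [← pow_succ']
        exact pow_le_pow_right₀ hL (by omega)
      · intro x a ha
        have := hA (Fin.cons c x) _ ha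
        rw [hd_cons, if_pos hcd] at this
        omega
    rw [sum_cons, sum_cons (fun x => if A x then (1 : ℝ) else 0), pow_succ']
    have n1 : ∀ c : Bool, 0 ≤ (∑ x, if A (Fin.cons c x) then (1 : ℝ) else 0) :=
      fun c => sum_nonneg fun x _ => by split_ifs <;> norm_num
    have hM : 0 ≤ (2 + L + 1 / L) ^ n := by positivity
    rcases le_total (∑ x, if A (Fin.cons false x) then (1 : ℝ) else 0)
      (∑ x, if A (Fin.cons true x) then (1 : ℝ) else 0) with hh | hh
    · exact iso_aux _ _ _ _ _ _ hL hM (n1 _) (n1 _) hh (same true) (same false)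
        (diff false true (by simp))
    · have := iso_aux _ _ _ _ _ _ hL hM (n1 _) (n1 _) hh (same false) (same true)
        (diff true false (by simp))
      rw [add_comm] at this
      rwa [add_comm (∑ x, if A (Fin.cons false x) then (1 : ℝ) else 0)] at this

def xr {n : ℕ} (x y : Fin n → Bool) : Fin n → Bool := fun j => xor (x j) (y j)

lemma card_off (n : ℕ) (p : Fin n → Prop) [DecidablePred p] (y : Fin n → Bool) :
    (univ.filter (fun b : Fin n → Bool => ∀ j, ¬ p j → b j = y j)).card ≤
      2 ^ (univ.filter p).card := by
  classical
  have : 2 ^ (univ.filter p).card = (univ : Finset ({j // p j} → Bool)).card := by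
    rw [card_univ, Fintype.card_fun, Fintype.card_bool, Fintype.card_subtype]
  rw [this]
  refine card_le_card_of_injOn (fun b j => b j.1) (fun _ _ => mem_coe.2 (mem_univ _)) ?_
  intro b hb c hc h
  simp only [mem_coe, mem_filter, mem_univ, true_and] at hb hc
  funext j
  by_cases hj : p j
  · exact congrFun h ⟨j, hj⟩
  · rw [hb j hj, hc j hj]

lemma exists_good (k : ℕ) (hk : 1 ≤ k) : ∃ f : (Fin (100 * k) → Bool) → Fin (2 ^ (82 * k)),
    ∀ (x₀ y₀ : Fin (100 * k) → Bool) (i : Fin (100 * k)), x₀ i ≠ y₀ i →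
      ∀ v : ℤ, -(2 * 2 ^ (82 * k)) ≤ v → v < 2 * 2 ^ (82 * k) →
      (hammingDist x₀ y₀ ≤ 80 * k →
        (univ.filter (fun b => ((∀ j, x₀ j = y₀ j → b j = y₀ j) ∧ b i = y₀ i) ∧
          ((f b : ℕ) : ℤ) + ((f (xr b (xr x₀ y₀)) : ℕ) : ℤ) = v)).card < 300) ∧
      (20 * k < hammingDist x₀ y₀ →
        (univ.filter (fun b => (∀ j, x₀ j ≠ y₀ j → b j = y₀ j) ∧
          ((f b : ℕ) : ℤ) - ((f (xr b (xr x₀ y₀)) : ℕ) : ℤ) = v)).card < 300) ∧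
      (∀ z, (univ.filter (fun b => (hammingDist z b ≤ 20 * k ∧ ∀ j, x₀ j ≠ y₀ j → b j = y₀ j) ∧
          ((f b : ℕ) : ℤ) - ((f (xr b (xr x₀ y₀)) : ℕ) : ℤ) = v)).card < 300) := by
  classical
  let V := Fin (100 * k) → Bool
  let ι := (Fin 3 × V × V × V) × (Fin (100 * k) × Fin (4 * 2 ^ (82 * k)))
  let D : ι → Finset V := fun j =>
    let x₀ := j.1.2.1
    let y₀ := j.1.2.2.1
    let z := j.1.2.2.2
    let i := j.2.1
    if x₀ i = y₀ i then ∅ else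
      if j.1.1 = 0 then
        if hammingDist x₀ y₀ ≤ 80 * k then
          univ.filter (fun b => (∀ j, x₀ j = y₀ j → b j = y₀ j) ∧ b i = y₀ i) else ∅
      else if j.1.1 = 1 then
        if 20 * k < hammingDist x₀ y₀ then
          univ.filter (fun b => (∀ j, x₀ j ≠ y₀ j → b j = y₀ j)) else ∅
      else univ.filter (fun b => hammingDist z b ≤ 20 * k ∧ (∀ j, x₀ j ≠ y₀ j → b j = y₀ j))
  have hDi : ∀ j, ∀ b ∈ D j, j.1.2.1 j.2.1 ≠ j.1.2.2.1 j.2.1 ∧ b j.2.1 = j.1.2.2.1 j.2.1 := by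
    rintro ⟨⟨c, x₀, y₀, z⟩, i, t⟩ b hb
    simp only [D] at hb ⊢
    split_ifs at hb with h1 h2 h3 h4 h5
    · simp at hb
    · exact ⟨h1, (mem_filter.1 hb).2.2⟩
    · simp at hb
    · exact ⟨h1, (mem_filter.1 hb).2 i h1⟩
    · simp at hb
    · exact ⟨h1, (mem_filter.1 hb).2.2 i h1⟩
  have hDc : ∀ j, (D j).card ≤ 2 ^ (80 * k) := by
    rintro ⟨⟨c, x₀, y₀, z⟩, i, t⟩
    simp only [D]
    split_ifs with h1 h2 h3 h4 h5
    · simp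
    · refine (card_le_card ?_).trans ((card_off _ (fun j => x₀ j ≠ y₀ j) y₀).trans
        (Nat.pow_le_pow_right (by norm_num) h3))
      intro b hb
      simp only [mem_filter, mem_univ, true_and, not_not] at hb ⊢
      exact hb.1
    · simp
    · refine (card_le_card ?_).trans ((card_off _ (fun j => ¬ x₀ j ≠ y₀ j) y₀).trans
        (Nat.pow_le_pow_right (by norm_num) ?_))
      · intro b hb
        simp only [mem_filter, mem_univ, true_and, not_not] at hb ⊢
        exact hb
      · have := card_filter_add_card_filter_not (s := (univ : Finset (Fin (100 * k)))) (fun j => x₀ j ≠ y₀ j)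
        rw [card_univ, Fintype.card_fin] at this
        unfold hammingDist at h5
        omega
    · simp
    · refine (card_le_card ?_).trans (ball1 k z)
      intro b hb
      simp only [mem_filter, mem_univ, true_and] at hb ⊢
      exact hb.1
  obtain ⟨f, hf⟩ := exist_f (V := V) (ι := ι) (2 ^ (82 * k)) (2 ^ (80 * k)) 300 (by positivity) D
    (fun j b => xr b (xr j.1.2.1 j.1.2.2.1)) (fun j => if j.1.1 = 0 then 1 else -1)
    (fun j => (j.2.2 : ℕ) - 2 * 2 ^ (82 * k)) (by
      intro j b hb hb'
      have h1 := hDi j b hb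
      have h2 := hDi j _ hb'
      have h3 := h2.2
      simp only [xr] at h3
      rw [h1.2] at h3
      have h4 := h1.1
      revert h3 h4
      cases j.1.2.1 j.2.1 <;> cases j.1.2.2.1 j.2.1 <;> simp) hDc (by
      simp only [ι, V, Fintype.card_prod, Fintype.card_fin, Fintype.card_fun, Fintype.card_bool]
      have hk2 : k < 2 ^ k := Nat.lt_two_pow_self
      have e0 : 3 * (2 ^ (100 * k) * (2 ^ (100 * k) * 2 ^ (100 * k))) *
          (100 * k * (4 * 2 ^ (82 * k))) = 1200 * k * 2 ^ (382 * k) := by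
        rw [show 382 * k = 100 * k + (100 * k + 100 * k) + 82 * k by ring]
        simp only [pow_add]; ring
      have e1 : 1200 * k < 2 ^ (218 * k) := by
        have : 2 ^ (11 + k) ≤ 2 ^ (218 * k) := Nat.pow_le_pow_right (by norm_num) (by omega)
        rw [pow_add] at this
        omega
      rw [e0]
      calc 1200 * k * 2 ^ (382 * k) * (2 ^ (80 * k)) ^ 300
          < 2 ^ (218 * k) * 2 ^ (382 * k) * (2 ^ (80 * k)) ^ 300 := by gcongr
        _ = (2 ^ (82 * k)) ^ 300 := by
          rw [← pow_mul, ← pow_mul, ← pow_add, ← pow_add]; congr 1; ring)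
  refine ⟨f, ?_⟩
  intro x₀ y₀ i hi v hv1 hv2
  obtain ⟨t, ht⟩ : ∃ t : Fin (4 * 2 ^ (82 * k)), ((t : ℕ) : ℤ) - 2 * 2 ^ (82 * k) = v := by
    obtain ⟨m, hm⟩ := Int.eq_ofNat_of_zero_le (a := v + 2 * 2 ^ (82 * k)) (by linarith)
    refine ⟨⟨m, ?_⟩, ?_⟩
    · have : (m : ℤ) < 4 * 2 ^ (82 * k) := by
        have : v + 2 * 2 ^ (82 * k) = (m : ℤ) := hm
        linarith
      exact_mod_cast this
    · simp only; linarith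
  refine ⟨?_, ?_, ?_⟩
  · intro hd
    have := hf ((0, x₀, y₀, x₀), (i, t))
    simp only [D, if_neg hi, if_pos hd, if_true, filter_filter, ht, one_mul] at this
    exact this
  · intro hd
    have := hf ((1, x₀, y₀, x₀), (i, t))
    simp only [D, if_neg hi, if_pos hd, if_true, filter_filter, ht, one_ne_zero, if_false] at this
    simpa only [neg_one_mul, ← sub_eq_add_neg] using this
  · intro z
    have := hf ((2, x₀, y₀, z), (i, t))
    have h20 : (2 : Fin 3) ≠ 0 := by decide
    have h21 : (2 : Fin 3) ≠ 1 := by decide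
    simp only [D, if_neg hi, if_neg h20, if_neg h21, filter_filter, ht] at this
    simpa only [neg_one_mul, ← sub_eq_add_neg] using this

/-- base 5 encoding -/
def enc {n : ℕ} (x : Fin n → Bool) : ℤ := ∑ j, ((x j).toNat : ℤ) * 5 ^ (j : ℕ)

lemma digits_zero : ∀ (n : ℕ) (a : Fin n → ℤ), (∀ j, |a j| ≤ 2) →
    ∑ j, a j * 5 ^ (j : ℕ) = 0 → ∀ j, a j = 0 := by
  intro n
  induction n with
  | zero => intro a _ _ j; exact j.elim0
  | succ n ih =>
    intro a ha h
    rw [Fin.sum_univ_succ] at h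
    simp only [Fin.val_zero, pow_zero, mul_one, Fin.val_succ, pow_succ, ← mul_assoc, ← sum_mul] at h
    have h0 := abs_le.1 (ha 0)
    have e : a 0 = 0 := by omega
    have e2 : ∑ j : Fin n, a j.succ * 5 ^ (j : ℕ) = 0 := by omega
    have := ih (fun j => a j.succ) (fun j => ha _) e2
    intro j
    refine Fin.cases e this j

lemma enc_add {n : ℕ} {x y z w : Fin n → Bool} (h : enc x + enc y = enc z + enc w) (j : Fin n) :
    (x j).toNat + (y j).toNat = (z j).toNat + (w j).toNat := by
  have := digits_zero n (fun j => ((x j).toNat : ℤ) + (y j).toNat - (z j).toNat - (w j).toNat) ?_ ?_ j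
  · omega
  · intro j
    have := (x j).toNat_le; have := (y j).toNat_le; have := (z j).toNat_le
    have := (w j).toNat_le
    rw [abs_le]; constructor <;> omega
  · simp only [enc] at h
    simp only [sub_mul, add_mul, sum_sub_distrib, sum_add_distrib]
    linarith

lemma enc_inj {n : ℕ} {x y : Fin n → Bool} (h : enc x = enc y) : x = y := by
  funext j
  have := enc_add (x := x) (y := x) (z := y) (w := x) (by rw [h]) j
  revert this
  cases x j <;> cases y j <;> simp

/-- the point set -/
def pt {n Q : ℕ} (f : (Fin n → Bool) → Fin Q) (x : Fin n → Bool) : ℤ × ℤ := (enc x, ((f x : ℕ) : ℤ))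

lemma pt_inj {n Q : ℕ} (f : (Fin n → Bool) → Fin Q) : Function.Injective (pt f) :=
  fun _ _ h => enc_inj (congrArg Prod.fst h)

lemma dichotomy {V : Type} [DecidableEq V] (X : Finset V) (R : V → V → Prop) [∀ x y, Decidable (R x y)] :
    X.card ^ 2 ≤ 2 * ((X ×ˢ X).filter (fun p => R p.1 p.2)).card ∨
    ∃ x₀ ∈ X, X.card ≤ 2 * (X.filter (fun x => ¬ R x₀ x)).card := by
  by_cases h : ∃ x₀ ∈ X, X.card ≤ 2 * (X.filter (fun x => ¬ R x₀ x)).card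
  · exact Or.inr h
  left
  push Not at h
  have e : ((X ×ˢ X).filter (fun p => R p.1 p.2)).card = ∑ x ∈ X, (X.filter (fun y => R x y)).card := by
    rw [card_filter, sum_product]
    simp only [card_filter]
  rw [e, mul_sum, sq]
  calc X.card * X.card = ∑ x ∈ X, X.card := by simp
    _ ≤ _ := sum_le_sum fun x hx => by
      have h1 := h x hx
      have h2 := card_filter_add_card_filter_not (s := X) (fun y => R x y)
      omega

lemma bool_sum {a b a₀ b₀ : Bool} (h : a.toNat + b.toNat = a₀.toNat + b₀.toNat) :
    a = xor b (xor a₀ b₀) ∧ a = xor b (xor b₀ a₀) ∧ (a₀ = b₀ → b = b₀ ∧ b = a₀) ∧ (b = b₀ ∨ b = a₀) := by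
  revert h
  cases a <;> cases b <;> cases a₀ <;> cases b₀ <;> simp

lemma bool_diff {a b a₀ b₀ : Bool} (h : a.toNat + b₀.toNat = a₀.toNat + b.toNat) :
    a = xor b (xor a₀ b₀) ∧ (a₀ ≠ b₀ → b = b₀) := by
  revert h
  cases a <;> cases b <;> cases a₀ <;> cases b₀ <;> simp

lemma far_far {n : ℕ} (x a b : Fin n → Bool) :
    hammingDist a b + hammingDist x a + hammingDist x b ≤ 2 * n := by
  have h : ∀ j, (if a j ≠ b j then 1 else 0) + (if x j ≠ a j then 1 else 0) +
      (if x j ≠ b j then 1 else 0) ≤ 2 := by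
    intro j
    cases x j <;> cases a j <;> cases b j <;> simp
  simp only [hammingDist, card_filter, ← sum_add_distrib]
  refine (sum_le_sum fun j _ => h j).trans ?_
  simp [mul_comm]

lemma sum_big (k : ℕ) (f : (Fin (100 * k) → Bool) → Fin (2 ^ (82 * k)))
    (hf : ∀ (x₀ y₀ : Fin (100 * k) → Bool) (i : Fin (100 * k)), x₀ i ≠ y₀ i →
      ∀ v : ℤ, -(2 * 2 ^ (82 * k)) ≤ v → v < 2 * 2 ^ (82 * k) →
      hammingDist x₀ y₀ ≤ 80 * k →
        (univ.filter (fun b => ((∀ j, x₀ j = y₀ j → b j = y₀ j) ∧ b i = y₀ i) ∧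
          ((f b : ℕ) : ℤ) + ((f (xr b (xr x₀ y₀)) : ℕ) : ℤ) = v)).card < 300)
    (X : Finset (Fin (100 * k) → Bool)) :
    X.card ^ 2 ≤ 2404 * (X.image (pt f) + X.image (pt f)).card := by
  classical
  set A := X.image (pt f) with hA
  let P := (X ×ˢ X).filter (fun p => p.1 ≠ p.2 ∧ hammingDist p.1 p.2 ≤ 80 * k)
  have hAc : A.card = X.card := card_image_of_injective _ (pt_inj f)
  have claim3 : X.card ≤ (A + A).card := by
    rw [← hAc]
    rcases A.eq_empty_or_nonempty with h | h
    · simp [h]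
    · exact card_le_card_add_left h
  have claim1 : P.card ≤ 600 * (A + A).card := by
    have h1 : P.card ≤ 600 * (P.image (fun p => pt f p.1 + pt f p.2)).card := by
      refine card_le_mul_card_image _ _ ?_
      intro w hw
      obtain ⟨⟨x₀, y₀⟩, hp, rfl⟩ := mem_image.1 hw
      simp only [P, mem_filter, mem_product] at hp
      obtain ⟨i, hi⟩ := Function.ne_iff.1 hp.2.1
      have hd := hp.2.2
      have hd' : hammingDist y₀ x₀ ≤ 80 * k := by rwa [hammingDist_comm]
      have b1 : ((f x₀ : ℕ) : ℤ) < 2 ^ (82 * k) := by exact_mod_cast (f x₀).2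
      have b2 : ((f y₀ : ℕ) : ℤ) < 2 ^ (82 * k) := by exact_mod_cast (f y₀).2
      have c1 := hf x₀ y₀ i hi ((f x₀ : ℕ) + (f y₀ : ℕ)) (by linarith [Int.natCast_nonneg (f x₀ : ℕ), Int.natCast_nonneg (f y₀ : ℕ)]) (by linarith) hd
      have c2 := hf y₀ x₀ i hi.symm ((f x₀ : ℕ) + (f y₀ : ℕ)) (by linarith [Int.natCast_nonneg (f x₀ : ℕ), Int.natCast_nonneg (f y₀ : ℕ)]) (by linarith) hd'
      have key : ∀ p : (Fin (100 * k) → Bool) × (Fin (100 * k) → Bool),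
          pt f p.1 + pt f p.2 = pt f x₀ + pt f y₀ →
          p.1 = xr p.2 (xr x₀ y₀) ∧ p.1 = xr p.2 (xr y₀ x₀) ∧
          (∀ j, x₀ j = y₀ j → p.2 j = y₀ j ∧ p.2 j = x₀ j) ∧ (p.2 i = y₀ i ∨ p.2 i = x₀ i) ∧
          ((f p.2 : ℕ) : ℤ) + ((f p.1 : ℕ) : ℤ) = (f x₀ : ℕ) + (f y₀ : ℕ) := by
        intro p hp
        simp only [pt, Prod.mk_add_mk, Prod.mk.injEq] at hp
        have e := fun j => bool_sum (enc_add hp.1 j)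
        exact ⟨funext fun j => (e j).1, funext fun j => (e j).2.1, fun j => (e j).2.2.1,
          (e i).2.2.2, by rw [add_comm]; exact hp.2⟩
      refine le_trans (card_le_card_of_injOn (t := _ ∪ _) (fun p => p.2) ?_ ?_)
        ((card_union_le _ _).trans (add_le_add c1.le c2.le))
      · intro p hp
        obtain ⟨k1, k2, k3, k4, k5⟩ := key p (mem_filter.1 hp).2
        simp only [mem_coe, mem_union, mem_filter, mem_univ, true_and]
        rcases k4 with k4 | k4
        · left; exact ⟨⟨fun j hj => (k3 j hj).1, k4⟩, by rw [← k1]; exact k5⟩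
        · right; exact ⟨⟨fun j hj => (k3 j hj.symm).2, k4⟩, by rw [← k2]; exact k5⟩
      · intro p hp q hq hpq
        have k1 := (key p (mem_filter.1 hp).2).1
        have k2 := (key q (mem_filter.1 hq).2).1
        simp only at hpq
        refine Prod.ext ?_ hpq
        rw [k1, k2, hpq]
    refine h1.trans (Nat.mul_le_mul_left _ (card_le_card ?_))
    intro w hw
    obtain ⟨p, hp, rfl⟩ := mem_image.1 hw
    simp only [P, mem_filter, mem_product] at hp
    exact add_mem_add (mem_image_of_mem _ hp.1.1) (mem_image_of_mem _ hp.1.2)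
  have claim2 : X.card ^ 2 ≤ 4 * ((X ×ˢ X).filter (fun p => hammingDist p.1 p.2 ≤ 80 * k)).card := by
    rcases dichotomy X (fun x y => hammingDist x y ≤ 80 * k) with h | ⟨x₀, _, h⟩
    · omega
    · set N := X.filter (fun x => ¬ hammingDist x₀ x ≤ 80 * k)
      have : N.card * N.card ≤ ((X ×ˢ X).filter (fun p => hammingDist p.1 p.2 ≤ 80 * k)).card := by
        rw [← card_product]
        refine card_le_card ?_
        rintro ⟨a, b⟩ hab
        simp only [N, mem_product, mem_filter] at hab ⊢
        have := far_far x₀ a b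
        exact ⟨⟨hab.1.1, hab.2.1⟩, by omega⟩
      nlinarith
  have claim4 : ((X ×ˢ X).filter (fun p => hammingDist p.1 p.2 ≤ 80 * k)).card ≤ P.card + X.card := by
    rw [← diag_card X]
    refine (card_le_card ?_).trans (card_union_le _ _)
    rintro ⟨a, b⟩ hab
    simp only [P, mem_union, mem_filter, mem_product, mem_diag] at hab ⊢
    by_cases h : a = b
    · right; exact ⟨hab.1.1, h⟩
    · left; exact ⟨hab.1, h, hab.2⟩
  omega

lemma diff_fibre {n Q : ℕ} (f : (Fin n → Bool) → Fin Q) (P : Finset ((Fin n → Bool) × (Fin n → Bool)))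
    (hP : ∀ x₀ y₀ : Fin n → Bool, (x₀, y₀) ∈ P → ∃ B : Finset (Fin n → Bool), B.card ≤ 300 ∧
      ∀ x y, (x, y) ∈ P → (∀ j, x₀ j ≠ y₀ j → y j = y₀ j) →
        ((f y : ℕ) : ℤ) - ((f (xr y (xr x₀ y₀)) : ℕ) : ℤ) = (f y₀ : ℕ) - (f x₀ : ℕ) → y ∈ B)
    (A : Finset (ℤ × ℤ)) (hA : ∀ p ∈ P, pt f p.1 ∈ A ∧ pt f p.2 ∈ A) :
    P.card ≤ 300 * (A - A).card := by
  classical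
  have h1 : P.card ≤ 300 * (P.image (fun p => pt f p.1 - pt f p.2)).card := by
    refine card_le_mul_card_image _ _ ?_
    intro w hw
    obtain ⟨⟨x₀, y₀⟩, hp, rfl⟩ := mem_image.1 hw
    obtain ⟨B, hB, hB'⟩ := hP x₀ y₀ hp
    have key : ∀ p : (Fin n → Bool) × (Fin n → Bool),
        pt f p.1 - pt f p.2 = pt f x₀ - pt f y₀ →
        p.1 = xr p.2 (xr x₀ y₀) ∧ (∀ j, x₀ j ≠ y₀ j → p.2 j = y₀ j) ∧
        ((f p.2 : ℕ) : ℤ) - ((f p.1 : ℕ) : ℤ) = (f y₀ : ℕ) - (f x₀ : ℕ) := by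
      intro p hp
      simp only [pt, Prod.mk_sub_mk, Prod.mk.injEq] at hp
      have e := fun j => bool_diff (enc_add (x := p.1) (y := y₀) (z := x₀) (w := p.2) (by linarith) j)
      exact ⟨funext fun j => (e j).1, fun j => (e j).2, by linarith⟩
    refine le_trans (card_le_card_of_injOn (t := B) (fun p => p.2) ?_ ?_) hB
    · intro p hp
      obtain ⟨k1, k2, k3⟩ := key p (mem_filter.1 hp).2
      exact hB' p.1 p.2 (mem_filter.1 hp).1 k2 (by rw [← k1]; exact k3)
    · intro p hp q hq hpq
      have k1 := (key p (mem_filter.1 hp).2).1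
      have k2 := (key q (mem_filter.1 hq).2).1
      simp only at hpq
      refine Prod.ext ?_ hpq
      rw [k1, k2, hpq]
  refine h1.trans (Nat.mul_le_mul_left _ (card_le_card ?_))
  intro w hw
  obtain ⟨p, hp, rfl⟩ := mem_image.1 hw
  exact sub_mem_sub (hA p hp).1 (hA p hp).2

lemma diff_big (k : ℕ) (f : (Fin (100 * k) → Bool) → Fin (2 ^ (82 * k)))
    (hf : ∀ (x₀ y₀ : Fin (100 * k) → Bool) (i : Fin (100 * k)), x₀ i ≠ y₀ i →
      ∀ v : ℤ, -(2 * 2 ^ (82 * k)) ≤ v → v < 2 * 2 ^ (82 * k) →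
      (20 * k < hammingDist x₀ y₀ →
        (univ.filter (fun b => (∀ j, x₀ j ≠ y₀ j → b j = y₀ j) ∧
          ((f b : ℕ) : ℤ) - ((f (xr b (xr x₀ y₀)) : ℕ) : ℤ) = v)).card < 300) ∧
      (∀ z, (univ.filter (fun b => (hammingDist z b ≤ 20 * k ∧ ∀ j, x₀ j ≠ y₀ j → b j = y₀ j) ∧
          ((f b : ℕ) : ℤ) - ((f (xr b (xr x₀ y₀)) : ℕ) : ℤ) = v)).card < 300))
    (X : Finset (Fin (100 * k) → Bool)) :
    X.card ^ 2 ≤ 2404 * (X.image (pt f) - X.image (pt f)).card := by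
  classical
  set A := X.image (pt f) with hA
  have hAc : A.card = X.card := card_image_of_injective _ (pt_inj f)
  have claim3 : X.card ≤ (A - A).card := by
    rw [← hAc]
    rcases A.eq_empty_or_nonempty with h | h
    · simp [h]
    · exact card_le_card_sub_left h
  have hb : ∀ x : Fin (100 * k) → Bool, 0 ≤ ((f x : ℕ) : ℤ) ∧ ((f x : ℕ) : ℤ) < 2 ^ (82 * k) :=
    fun x => ⟨Int.natCast_nonneg _, by exact_mod_cast (f x).2⟩
  rcases dichotomy X (fun x y => 20 * k < hammingDist x y) with h | ⟨z, _, h⟩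
  · have := diff_fibre f ((X ×ˢ X).filter (fun p => 20 * k < hammingDist p.1 p.2)) (by
      intro x₀ y₀ hp
      have hd := (mem_filter.1 hp).2
      have hne : x₀ ≠ y₀ := by
        rintro rfl
        simp at hd
      obtain ⟨i, hi⟩ := Function.ne_iff.1 hne
      refine ⟨_, ((hf x₀ y₀ i hi ((f y₀ : ℕ) - (f x₀ : ℕ)) (by linarith [hb x₀, hb y₀])
        (by linarith [hb x₀, hb y₀])).1 hd).le, ?_⟩
      intro x y _ h1 h2
      simp only [mem_filter, mem_univ, true_and]
      exact ⟨h1, h2⟩) A (by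
      intro p hp
      simp only [mem_filter, mem_product] at hp
      exact ⟨mem_image_of_mem _ hp.1.1, mem_image_of_mem _ hp.1.2⟩)
    omega
  · set N := X.filter (fun x => ¬ 20 * k < hammingDist z x)
    have h5 := diff_fibre f N.offDiag (by
      intro x₀ y₀ hp
      have hne : x₀ ≠ y₀ := (mem_offDiag.1 hp).2.2
      obtain ⟨i, hi⟩ := Function.ne_iff.1 hne
      refine ⟨_, ((hf x₀ y₀ i hi ((f y₀ : ℕ) - (f x₀ : ℕ)) (by linarith [hb x₀, hb y₀])
        (by linarith [hb x₀, hb y₀])).2 z).le, ?_⟩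
      intro x y hxy h1 h2
      have : ¬ 20 * k < hammingDist z y := (mem_filter.1 (mem_offDiag.1 hxy).2.1).2
      simp only [mem_filter, mem_univ, true_and]
      exact ⟨⟨by omega, h1⟩, h2⟩) A (by
      intro p hp
      rw [mem_offDiag] at hp
      exact ⟨mem_image_of_mem _ (mem_filter.1 hp.1).1, mem_image_of_mem _ (mem_filter.1 hp.2.1).1⟩)
    rw [offDiag_card] at h5
    have h6 : N.card ≤ X.card := card_filter_le _ _
    have h7 : X.card ^ 2 ≤ 4 * (N.card * N.card) := by nlinarith
    omega

/-- contraction ratio in the concentration bound -/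
noncomputable def rho : ℝ := (2 + 51 / 50 + 1 / (51 / 50)) ^ 100 / (4 ^ 100 * (51 / 50))

lemma rho_nonneg : 0 ≤ rho := by unfold rho; positivity

lemma rho_lt : rho < 1 := by unfold rho; norm_num

lemma near (k : ℕ) (X : Finset (Fin (100 * k) → Bool)) (δ : ℝ) (hδ : 0 < δ)
    (hX : δ * 2 ^ (100 * k) ≤ (X.card : ℝ)) (hk : rho ^ k ≤ δ ^ 2 / 2) :
    δ / 2 * 2 ^ (100 * k) ≤
      ((X.filter (fun x => ∃ y ∈ X, hammingDist (fun j => !(x j)) y ≤ k)).card : ℝ) := by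
  classical
  set Fr := (univ : Finset (Fin (100 * k) → Bool)).filter (fun x => ∀ y ∈ X, k ≤ hammingDist x y) with hFr
  have h1 := iso (51 / 50) (by norm_num) (100 * k) (fun x => x ∈ X)
    (fun x => if x ∈ Fr then k else 0) (by
      intro x a ha
      split_ifs with h
      · exact (mem_filter.1 h).2 a ha
      · exact Nat.zero_le _)
  have h2 : (∑ x : Fin (100 * k) → Bool, if x ∈ X then (1 : ℝ) else 0) = X.card := by simp
  rw [h2] at h1
  have h3 : (Fr.card : ℝ) * (51 / 50) ^ k ≤
      ∑ x : Fin (100 * k) → Bool, (51 / 50 : ℝ) ^ (if x ∈ Fr then k else 0) := by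
    rw [← nsmul_eq_mul, ← sum_const]
    refine (sum_le_sum ?_).trans (sum_le_sum_of_subset_of_nonneg (subset_univ Fr)
      (fun _ _ _ => by positivity))
    intro x hx
    rw [if_pos hx]
  have h4 : (Fr.card : ℝ) * (51 / 50) ^ k * X.card ≤ (2 + 51 / 50 + 1 / (51 / 50)) ^ (100 * k) :=
    (mul_le_mul_of_nonneg_right h3 (by positivity)).trans h1
  have h5 : ((2 + 51 / 50 + 1 / (51 / 50)) ^ (100 * k) : ℝ) =
      rho ^ k * (2 ^ (100 * k) * 2 ^ (100 * k)) * (51 / 50) ^ k := by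
    have key : ((2 + 51 / 50 + 1 / (51 / 50)) ^ 100 : ℝ) = rho * 4 ^ 100 * (51 / 50) := by
      have hc : (4 : ℝ) ^ 100 ≠ 0 := pow_ne_zero _ (by norm_num)
      unfold rho
      generalize (4 : ℝ) ^ 100 = c at hc
      generalize (2 + 51 / 50 + 1 / (51 / 50) : ℝ) ^ 100 = a
      field_simp
    rw [← mul_pow, show (2 : ℝ) * 2 = 4 by norm_num, pow_mul, pow_mul, key, mul_pow, mul_pow]
  rw [h5] at h4
  have h6 : (Fr.card : ℝ) * X.card ≤ rho ^ k * (2 ^ (100 * k) * 2 ^ (100 * k)) := by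
    refine le_of_mul_le_mul_right ?_ (show (0 : ℝ) < (51 / 50) ^ k by positivity)
    linarith
  have h7 : (Fr.card : ℝ) ≤ δ / 2 * 2 ^ (100 * k) := by
    have hp : (0 : ℝ) < 2 ^ (100 * k) := by positivity
    refine le_of_mul_le_mul_right ?_ (mul_pos hδ hp)
    calc (Fr.card : ℝ) * (δ * 2 ^ (100 * k)) ≤ Fr.card * X.card := by gcongr
      _ ≤ _ := h6
      _ ≤ δ ^ 2 / 2 * (2 ^ (100 * k) * 2 ^ (100 * k)) := by gcongr
      _ = _ := by ring
  have h8 := card_filter_add_card_filter_not (s := X)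
    (fun x => ∃ y ∈ X, hammingDist (fun j => !(x j)) y ≤ k)
  have h9 : (X.filter (fun x => ¬ ∃ y ∈ X, hammingDist (fun j => !(x j)) y ≤ k)).card ≤ Fr.card := by
    refine card_le_card_of_injOn (fun x j => !(x j)) ?_ ?_
    · intro x hx
      have hx' := (mem_filter.1 (mem_coe.1 hx)).2
      push Not at hx'
      simp only [hFr, mem_coe, mem_filter, mem_univ, true_and]
      exact fun y hy => (hx' y hy).le
    · intro x _ y _ h
      funext j
      have := congrFun h j
      simpa using this
  have h10 : (X.card : ℝ) ≤ ((X.filter (fun x => ∃ y ∈ X, hammingDist (fun j => !(x j)) y ≤ k)).card : ℝ)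
      + Fr.card := by
    rw [← h8]
    exact_mod_cast Nat.add_le_add_left h9 _
  linarith

lemma bool_code {a b a' b' : Bool} (h1 : (!(xor a b)) = !(xor a' b')) (h2 : (a && b) = (a' && b')) :
    a.toNat + b.toNat = a'.toNat + b'.toNat := by
  revert h1 h2
  cases a <;> cases b <;> cases a' <;> cases b' <;> simp

lemma enc_add_of {n : ℕ} {x y z w : Fin n → Bool}
    (h : ∀ j, (x j).toNat + (y j).toNat = (z j).toNat + (w j).toNat) :
    enc x + enc y = enc z + enc w := by
  unfold enc
  rw [← sum_add_distrib, ← sum_add_distrib]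
  refine sum_congr rfl fun j _ => ?_
  rw [← add_mul, ← add_mul]
  congr 1
  exact_mod_cast h j

lemma pop_sum (k : ℕ) (f : (Fin (100 * k) → Bool) → Fin (2 ^ (82 * k)))
    (X : Finset (Fin (100 * k) → Bool)) (δ : ℝ) (hδ : 0 < δ) (g : ℕ)
    (hX : δ * 2 ^ (100 * k) ≤ (X.card : ℝ)) (hk : rho ^ k ≤ δ ^ 2 / 2)
    (hg : 8 * (g : ℝ) < δ * 2 ^ k) : ¬ IsB2 g (X.image (pt f) : Set (ℤ × ℤ)) := by
  classical
  intro hB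
  have hn := near k X δ hδ hX hk
  set G := X.filter (fun x => ∃ y ∈ X, hammingDist (fun j => !(x j)) y ≤ k) with hG
  have hex : ∀ x, ∃ y, x ∈ G → y ∈ X ∧ hammingDist (fun j => !(x j)) y ≤ k := by
    intro x
    by_cases hx : x ∈ G
    · obtain ⟨y, hy⟩ := (mem_filter.1 hx).2
      exact ⟨y, fun _ => hy⟩
    · exact ⟨x, fun h => absurd h hx⟩
  choose y hy using hex
  let o : Fin (100 * k) → Bool := fun _ => false
  let Bl := (univ : Finset (Fin (100 * k) → Bool)).filter (fun b => hammingDist o b ≤ k)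
  let code : (Fin (100 * k) → Bool) → (Fin (100 * k) → Bool) × (Fin (100 * k) → Bool) × ℕ := fun x =>
    (fun j => !(xor (x j) (y x j)), fun j => x j && y x j, (f x : ℕ) + (f (y x) : ℕ))
  have hmaps : ∀ x ∈ G, code x ∈ Bl ×ˢ Bl ×ˢ range (2 * 2 ^ (82 * k)) := by
    intro x hx
    have hd := (hy x hx).2
    simp only [code, Bl, mem_product, mem_filter, mem_univ, true_and, mem_range]
    refine ⟨le_trans ?_ hd, le_trans ?_ hd, ?_⟩
    · refine card_le_card ?_
      intro j
      simp only [mem_filter, mem_univ, true_and, o]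
      cases x j <;> cases y x j <;> simp
    · refine card_le_card ?_
      intro j
      simp only [mem_filter, mem_univ, true_and, o]
      cases x j <;> cases y x j <;> simp
    · have := (f x).2
      have := (f (y x)).2
      omega
  have hlt : (Bl ×ˢ Bl ×ˢ range (2 * 2 ^ (82 * k))).card * (2 * g) < G.card := by
    have hBl : Bl.card ≤ 271 ^ k := ball2 k o
    have h1 : (Bl ×ˢ Bl ×ˢ range (2 * 2 ^ (82 * k))).card ≤ 2 * 2 ^ (99 * k) := by
      rw [card_product, card_product, card_range]
      calc Bl.card * (Bl.card * (2 * 2 ^ (82 * k))) ≤ 271 ^ k * (271 ^ k * (2 * 2 ^ (82 * k))) := by gcongr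
        _ = 2 * ((271 * 271) ^ k * 2 ^ (82 * k)) := by rw [mul_pow]; ring
        _ ≤ 2 * ((2 ^ 17) ^ k * 2 ^ (82 * k)) := by
          gcongr
          norm_num
        _ = 2 * 2 ^ (99 * k) := by rw [← pow_mul, ← pow_add]; congr 2; ring
    have h2 : ((2 * 2 ^ (99 * k) * (2 * g) : ℕ) : ℝ) < G.card := by
      refine lt_of_lt_of_le ?_ hn
      rw [show 100 * k = 99 * k + k by ring, pow_add]
      push_cast
      have hp : (0 : ℝ) < 2 ^ (99 * k) := by positivity
      nlinarith
    have h3 : 2 * 2 ^ (99 * k) * (2 * g) < G.card := by exact_mod_cast h2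
    exact lt_of_le_of_lt (Nat.mul_le_mul_right _ h1) h3
  obtain ⟨c, _, hc⟩ := exists_lt_card_fiber_of_mul_lt_card_of_maps_to hmaps hlt
  set T := G.filter (fun x => code x = c) with hT
  have hTne : T.Nonempty := card_pos.1 (by omega)
  obtain ⟨x₀, hx₀⟩ := hTne
  have hsum : ∀ x ∈ T, pt f x + pt f (y x) = pt f x₀ + pt f (y x₀) := by
    intro x hx
    have e : code x = code x₀ := (mem_filter.1 hx).2.trans (mem_filter.1 hx₀).2.symm
    simp only [code, Prod.mk.injEq] at e
    simp only [pt, Prod.mk_add_mk, Prod.mk.injEq]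
    exact ⟨enc_add_of fun j => bool_code (congrFun e.1 j) (congrFun e.2.1 j), by exact_mod_cast e.2.2⟩
  have h2 : T.card ≤ 2 * (T.image (fun x => s(pt f x, pt f (y x)))).card := by
    refine card_le_mul_card_image _ _ ?_
    intro w hw
    obtain ⟨x₁, hx₁, rfl⟩ := mem_image.1 hw
    refine (card_le_card (t := {x₁, y x₁}) ?_).trans card_le_two
    intro x hx
    have := (mem_filter.1 hx).2
    simp only [Sym2.eq_iff] at this
    simp only [mem_insert, mem_singleton]
    rcases this with h | h
    · left; exact pt_inj f h.1
    · right; exact pt_inj f h.1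
  have h3 := hB (pt f x₀ + pt f (y x₀))
  have h4 : ((T.image (fun x => s(pt f x, pt f (y x))) : Finset _) : Set (Sym2 (ℤ × ℤ))).encard ≤ g := by
    refine le_trans (Set.encard_le_encard ?_) h3
    intro w hw
    obtain ⟨x, hx, rfl⟩ := mem_image.1 (mem_coe.1 hw)
    have hxG := (mem_filter.1 hx).1
    exact ⟨pt f x, mem_coe.2 (mem_image_of_mem _ (mem_filter.1 hxG).1), pt f (y x),
      mem_coe.2 (mem_image_of_mem _ (hy x hxG).1), rfl, hsum x hx⟩
  rw [Set.encard_coe_eq_coe_finsetCard] at h4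
  have h5 : (T.image (fun x => s(pt f x, pt f (y x)))).card ≤ g := by exact_mod_cast h4
  omega

lemma pop_diff (k : ℕ) (f : (Fin (100 * k) → Bool) → Fin (2 ^ (82 * k)))
    (X : Finset (Fin (100 * k) → Bool)) (δ : ℝ) (g : ℕ) (hg1 : 0 < g)
    (hX : δ * 2 ^ (100 * k) ≤ (X.card : ℝ))
    (hg : 8 * (g : ℝ) < δ * 2 ^ k) : ¬ IsB2Circ g (X.image (pt f) : Set (ℤ × ℤ)) := by
  classical
  intro hB
  set G := X.filter (fun x => ∃ y ∈ X, y ≠ x ∧ ∀ j : Fin (100 * k), k ≤ (j : ℕ) → x j = y j) with hG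
  have hn : δ / 2 * 2 ^ (100 * k) ≤ (G.card : ℝ) := by
    have h8 := card_filter_add_card_filter_not (s := X)
      (fun x => ∃ y ∈ X, y ≠ x ∧ ∀ j : Fin (100 * k), k ≤ (j : ℕ) → x j = y j)
    have h9 : (X.filter (fun x => ¬ ∃ y ∈ X, y ≠ x ∧ ∀ j : Fin (100 * k), k ≤ (j : ℕ) → x j = y j)).card
        ≤ 2 ^ (99 * k) := by
      have : 2 ^ (99 * k) = (univ : Finset (Fin (99 * k) → Bool)).card := by
        rw [card_univ, Fintype.card_fun, Fintype.card_bool, Fintype.card_fin]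
      rw [this]
      refine card_le_card_of_injOn (fun x j => x ⟨k + j, by omega⟩) (fun _ _ => mem_coe.2 (mem_univ _)) ?_
      intro x hx z hz h
      by_contra hne
      refine (mem_filter.1 (mem_coe.1 hx)).2 ⟨z, (mem_filter.1 (mem_coe.1 hz)).1, fun e => hne e.symm, ?_⟩
      intro j hj
      have := congrFun h ⟨j - k, by omega⟩
      have e : (⟨k + (j - k), by omega⟩ : Fin (100 * k)) = j := Fin.ext (by simp; omega)
      simpa only [e] using this
    have h10 : (X.card : ℝ) ≤ (G.card : ℝ) + 2 ^ (99 * k) := by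
      rw [← h8]
      exact_mod_cast Nat.add_le_add_left h9 _
    have h11 : (2 : ℝ) ^ (99 * k) ≤ δ / 2 * 2 ^ (100 * k) := by
      have hg2 : (1 : ℝ) ≤ g := by exact_mod_cast hg1
      have hp : (0 : ℝ) < 2 ^ (99 * k) := by positivity
      rw [show 100 * k = 99 * k + k by ring, pow_add]
      nlinarith
    linarith
  have hex : ∀ x, ∃ y, x ∈ G → y ∈ X ∧ y ≠ x ∧ ∀ j : Fin (100 * k), k ≤ (j : ℕ) → x j = y j := by
    intro x
    by_cases hx : x ∈ G
    · obtain ⟨y, hy⟩ := (mem_filter.1 hx).2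
      exact ⟨y, fun _ => hy⟩
    · exact ⟨x, fun h => absurd h hx⟩
  choose y hy using hex
  let res : (Fin (100 * k) → Bool) → (Fin k → Bool) := fun x j => x ⟨j, by omega⟩
  let code : (Fin (100 * k) → Bool) → (Fin k → Bool) × (Fin k → Bool) × ℤ := fun x =>
    (res x, res (y x), ((f x : ℕ) : ℤ) - (f (y x) : ℕ))
  have hmaps : ∀ x ∈ G, code x ∈ (univ : Finset (Fin k → Bool)) ×ˢ (univ : Finset (Fin k → Bool)) ×ˢ
      Ico (-((2 ^ (82 * k) : ℕ) : ℤ)) ((2 ^ (82 * k) : ℕ) : ℤ) := by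
    intro x hx
    simp only [code, mem_product, mem_univ, true_and, mem_Ico]
    have := (f x).2
    have := (f (y x)).2
    omega
  have hlt : ((univ : Finset (Fin k → Bool)) ×ˢ (univ : Finset (Fin k → Bool)) ×ˢ
      Ico (-((2 ^ (82 * k) : ℕ) : ℤ)) ((2 ^ (82 * k) : ℕ) : ℤ)).card * g < G.card := by
    have h1 : ((univ : Finset (Fin k → Bool)) ×ˢ (univ : Finset (Fin k → Bool)) ×ˢ
      Ico (-((2 ^ (82 * k) : ℕ) : ℤ)) ((2 ^ (82 * k) : ℕ) : ℤ)).card ≤ 2 * 2 ^ (99 * k) := by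
      rw [card_product, card_product, Int.card_Ico, card_univ, Fintype.card_fun, Fintype.card_bool,
        Fintype.card_fin]
      have e : (((2 ^ (82 * k) : ℕ) : ℤ) - -((2 ^ (82 * k) : ℕ) : ℤ)).toNat = 2 * 2 ^ (82 * k) := by omega
      rw [e]
      calc 2 ^ k * (2 ^ k * (2 * 2 ^ (82 * k))) = 2 * 2 ^ (84 * k) := by
            rw [show 84 * k = k + (k + 82 * k) by ring, pow_add, pow_add]; ring
        _ ≤ 2 * 2 ^ (99 * k) := by gcongr <;> omega
    have h2 : ((2 * 2 ^ (99 * k) * g : ℕ) : ℝ) < G.card := by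
      refine lt_of_lt_of_le ?_ hn
      rw [show 100 * k = 99 * k + k by ring, pow_add]
      push_cast
      have hp : (0 : ℝ) < 2 ^ (99 * k) := by positivity
      have hg2 : (1 : ℝ) ≤ g := by exact_mod_cast hg1
      nlinarith
    have h3 : 2 * 2 ^ (99 * k) * g < G.card := by exact_mod_cast h2
    exact lt_of_le_of_lt (Nat.mul_le_mul_right _ h1) h3
  obtain ⟨c, _, hc⟩ := exists_lt_card_fiber_of_mul_lt_card_of_maps_to hmaps hlt
  set T := G.filter (fun x => code x = c) with hT
  have hTne : T.Nonempty := card_pos.1 (by omega)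
  obtain ⟨x₀, hx₀⟩ := hTne
  have hx₀G := (mem_filter.1 hx₀).1
  have hsum : ∀ x ∈ T, pt f x - pt f (y x) = pt f x₀ - pt f (y x₀) := by
    intro x hx
    have hxG := (mem_filter.1 hx).1
    have e : code x = code x₀ := (mem_filter.1 hx).2.trans (mem_filter.1 hx₀).2.symm
    simp only [code, Prod.mk.injEq] at e
    have := enc_add_of (x := x) (y := y x₀) (z := x₀) (w := y x) (by
      intro j
      by_cases hj : k ≤ (j : ℕ)
      · rw [(hy x hxG).2.2 j hj, (hy x₀ hx₀G).2.2 j hj, add_comm]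
      · have e1 := congrFun e.1 ⟨j, by omega⟩
        have e2 := congrFun e.2.1 ⟨j, by omega⟩
        simp only [res] at e1 e2
        rw [e1, e2])
    simp only [pt, Prod.mk_sub_mk, Prod.mk.injEq]
    exact ⟨by linarith, e.2.2⟩
  have h3 := hB (pt f x₀ - pt f (y x₀)) (by
    intro h
    exact (hy x₀ hx₀G).2.1 (pt_inj f (sub_eq_zero.1 h)).symm)
  have h4 : ((T.image (fun x => (pt f x, pt f (y x))) : Finset _) : Set ((ℤ × ℤ) × (ℤ × ℤ))).encard ≤ g := by
    refine le_trans (Set.encard_le_encard ?_) h3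
    intro w hw
    obtain ⟨x, hx, rfl⟩ := mem_image.1 (mem_coe.1 hw)
    have hxG := (mem_filter.1 hx).1
    exact ⟨mem_coe.2 (mem_image_of_mem _ (mem_filter.1 hxG).1),
      mem_coe.2 (mem_image_of_mem _ (hy x hxG).1), hsum x hx⟩
  rw [Set.encard_coe_eq_coe_finsetCard, card_image_of_injective _
    (fun a b h => pt_inj f (congrArg Prod.fst h))] at h4
  have h5 : T.card ≤ g := by exact_mod_cast h4
  omega

end S9

theorem stmt_9 :
    ∃ δ : ℝ, 0 < δ ∧
      ∀ g : ℕ, 0 < g → ∀ δ' : ℝ, 0 < δ' →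
        ∃ A : Set (ℤ × ℤ), A.Finite ∧ A.Nonempty ∧
          (∀ A' ⊆ A,
            δ * (A'.ncard : ℝ) ^ 2 ≤ ((A' + A').ncard : ℝ) ∧
            δ * (A'.ncard : ℝ) ^ 2 ≤ ((A' - A').ncard : ℝ)) ∧
          ∀ A'' ⊆ A, δ' * (A.ncard : ℝ) ≤ (A''.ncard : ℝ) →
            ¬ IsB2 g A'' ∧ ¬ IsB2Circ g A'' := by
  classical
  refine ⟨1 / 2404, by norm_num, ?_⟩
  intro g hg δ hδ
  obtain ⟨k, hk1, hk2, hk3⟩ : ∃ k : ℕ, 1 ≤ k ∧ S9.rho ^ k ≤ δ ^ 2 / 2 ∧ 8 * (g : ℝ) < δ * 2 ^ k := by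
    have t1 := (tendsto_pow_atTop_nhds_zero_of_lt_one S9.rho_nonneg S9.rho_lt).eventually_le_const
      (show (0 : ℝ) < δ ^ 2 / 2 by positivity)
    have t2 := (tendsto_pow_atTop_atTop_of_one_lt (show (1 : ℝ) < 2 by norm_num)).eventually_gt_atTop
      (8 * g / δ)
    obtain ⟨k, h1, h2, h3⟩ := ((Filter.eventually_ge_atTop 1).and (t1.and t2)).exists
    refine ⟨k, h1, h2, ?_⟩
    rw [div_lt_iff₀ hδ] at h3
    linarith
  obtain ⟨f, hf⟩ := S9.exists_good k hk1
  have hsub : ∀ A' ⊆ Set.range (S9.pt f), ∃ X : Finset (Fin (100 * k) → Bool),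
      A' = ((X.image (S9.pt f) : Finset (ℤ × ℤ)) : Set (ℤ × ℤ)) ∧ A'.ncard = X.card := by
    intro A' hA'
    have e : A' = (((Finset.univ.filter (fun x => S9.pt f x ∈ A')).image (S9.pt f) : Finset (ℤ × ℤ)) :
        Set (ℤ × ℤ)) := by
      ext w
      simp only [Finset.coe_image, Finset.coe_filter, Finset.mem_univ, true_and, Set.mem_image,
        Set.mem_ofPred_eq]
      constructor
      · intro hw
        obtain ⟨x, rfl⟩ := hA' hw
        exact ⟨x, hw, rfl⟩
      · rintro ⟨x, hx, rfl⟩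
        exact hx
    refine ⟨_, e, ?_⟩
    conv_lhs => rw [e]
    rw [Set.ncard_coe_finset, Finset.card_image_of_injective _ (S9.pt_inj f)]
  refine ⟨Set.range (S9.pt f), Set.finite_range _, Set.range_nonempty _, ?_, ?_⟩
  · intro A' hA'
    obtain ⟨X, e1, e2⟩ := hsub A' hA'
    have s1 := S9.sum_big k f (fun x y i hi v h1 h2 => (hf x y i hi v h1 h2).1) X
    have s2 := S9.diff_big k f (fun x y i hi v h1 h2 => (hf x y i hi v h1 h2).2) X
    rw [e2, e1, ← Finset.coe_add, ← Finset.coe_sub, Set.ncard_coe_finset, Set.ncard_coe_finset]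
    have s1' : (X.card : ℝ) ^ 2 ≤ 2404 * ((X.image (S9.pt f) + X.image (S9.pt f)).card : ℝ) := by
      exact_mod_cast s1
    have s2' : (X.card : ℝ) ^ 2 ≤ 2404 * ((X.image (S9.pt f) - X.image (S9.pt f)).card : ℝ) := by
      exact_mod_cast s2
    constructor <;> linarith
  · intro A'' hA'' hd
    obtain ⟨X, e1, e2⟩ := hsub A'' hA''
    have hc : (Set.range (S9.pt f)).ncard = 2 ^ (100 * k) := by
      rw [← Set.image_univ, Set.ncard_image_of_injective _ (S9.pt_inj f), Set.ncard_univ]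
      simp
    rw [hc, e2] at hd
    push_cast at hd
    rw [e1]
    exact ⟨S9.pop_sum k f X δ hδ g hd hk2 hk3, S9.pop_diff k f X δ g hg hd hk3⟩
end

section
/- There exists a real constant δ > 0 such that for every positive integer g and every real δ' > 0, there exists a nonempty finite set A ⊆ ℤ with the following properties: (i) for every subset A' ⊆ A, |A' + A'| ≥ δ·|A'|² and |A' − A'| ≥ δ·|A'|²; and (ii) no subset A'' ⊆ A with |A''| ≥ δ'·|A| is a B₂[g] set or a B₂°[g] set. -/
open scoped Pointwise

section helpers
open Finset


theorem exists_hom {κ : Type} [Fintype κ] (S : Finset (κ → ℤ)) :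
    ∃ h : (κ → ℤ) →+ ℤ, ∀ x ∈ S, h x = 0 → x = 0 := by
  classical
  let i : κ ≃ Fin (Fintype.card κ) := Fintype.equivFin κ
  let P : (κ → ℤ) → Polynomial ℤ := fun x => ∑ k, Polynomial.monomial (i k : ℕ) (x k)
  have hP : ∀ x, P x = 0 → x = 0 := by
    intro x hx
    funext k
    have := congrArg (fun p => Polynomial.coeff p (i k : ℕ)) hx
    simp only [P, Polynomial.finsetSum_coeff, Polynomial.coeff_monomial, Polynomial.coeff_zero] at this
    rw [Finset.sum_eq_single k] at this
    · simpa using this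
    · intro b _ hb
      rw [if_neg]
      intro h
      exact hb (i.injective (Fin.ext h))
    · simp
  let R : Polynomial ℤ := ∏ x ∈ S with x ≠ 0, P x
  have hR : R ≠ 0 := by
    rw [Finset.prod_ne_zero_iff]
    intro x hx h
    exact (Finset.mem_filter.1 hx).2 (hP x h)
  obtain ⟨M, hM⟩ : ∃ M : ℤ, R.eval M ≠ 0 := by
    by_contra! h
    exact hR (Polynomial.funext (by simpa using h))
  refine ⟨{ toFun := fun x => (P x).eval M, map_zero' := by simp [P], map_add' := ?_ }, ?_⟩
  · intro x y
    simp [P, Polynomial.eval_finsetSum, Finset.sum_add_distrib]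
  · intro x hx h
    by_contra hne
    apply hM
    simp only [R, Polynomial.eval_prod]
    exact Finset.prod_eq_zero (Finset.mem_filter.2 ⟨hx, hne⟩) h

theorem exists_model {α κ : Type} [Fintype α] [Fintype κ] (φ : α → κ → ℤ) :
    ∃ Φ : α → ℤ, ∀ a b c d, Φ a + Φ b = Φ c + Φ d ↔ φ a + φ b = φ c + φ d := by
  classical
  obtain ⟨h, hh⟩ := exists_hom (univ.image fun p : α × α × α × α =>
    φ p.1 + φ p.2.1 - (φ p.2.2.1 + φ p.2.2.2))
  refine ⟨fun a => h (φ a), fun a b c d => ⟨fun H => ?_, fun H => ?_⟩⟩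
  · refine sub_eq_zero.1 (hh _ (mem_image.2 ⟨(a, b, c, d), mem_univ _, rfl⟩) ?_)
    simp [H]
  · simp only [← map_add, H]

theorem energy_lemma (S : Finset ℤ)
    (h : ∀ ξ, #{p ∈ S ×ˢ S | p.1 + p.2 = ξ} ≤ 4) :
    #S ^ 2 ≤ 4 * #(S + S) ∧ #S ^ 2 ≤ 4 * #(S - S) := by
  have key : ∀ (s : ℤ), #S ^ 2 ≤ 4 * #(S + S) := by
    intro _
    have := Finset.card_le_mul_card_image_of_maps_to (s := S ×ˢ S) (t := S + S)
      (f := fun p => p.1 + p.2) (fun p hp => by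
        rw [mem_product] at hp; exact add_mem_add hp.1 hp.2) 4 (fun b _ => h b)
    simpa [sq] using this
  refine ⟨key 0, ?_⟩
  have h1 := le_card_add_mul_addEnergy S (-S)
  have h2 : S.addEnergy (-S) ≤ 4 * #S ^ 2 := by
    have : S.addEnergy (-S) ≤ #({q ∈ (S ×ˢ S) ×ˢ (S ×ˢ S) | q.1.1 + q.1.2 = q.2.1 + q.2.2}) := by
      rw [addEnergy]
      refine Finset.card_le_card_of_injOn (fun q => ((q.1.1, - q.2.2), (q.1.2, - q.2.1))) ?_ ?_
      · intro q hq
        simp at hq ⊢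
        refine ⟨⟨⟨hq.1.1.1, hq.1.2.2⟩, hq.1.1.2, hq.1.2.1⟩, by linarith [hq.2]⟩
      · rintro ⟨⟨a, b⟩, c, d⟩ _ ⟨⟨a', b'⟩, c', d'⟩ _ h
        simp at h ⊢
        tauto
    refine this.trans ?_
    have := Finset.card_le_mul_card_image_of_maps_to 
      (s := {q ∈ (S ×ˢ S) ×ˢ (S ×ˢ S) | q.1.1 + q.1.2 = q.2.1 + q.2.2}) (t := S ×ˢ S)
      (f := fun p => p.1) (fun p hp => by simp at hp ⊢; tauto) 4 (fun b _ => by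
        refine le_trans (Finset.card_le_card_of_injOn (fun q => q.2) ?_ ?_) (h (b.1 + b.2))
        · intro q hq
          simp at hq ⊢
          refine ⟨hq.1.1.2, ?_⟩
          rw [← hq.2, hq.1.2]
        · intro q hq q' hq' hh
          simp at hq hq' hh
          exact Prod.ext (hq.2.trans hq'.2.symm) hh)
    simpa [sq] using this
  rw [← sub_eq_add_neg, card_neg] at h1
  rcases Nat.eq_zero_or_pos (#S) with h0 | h0
  · simp [h0]
  · have : #S ^ 2 * #S ^ 2 ≤ #S ^ 2 * (4 * #(S - S)) := by nlinarith
    exact Nat.le_of_mul_le_mul_left this (by positivity)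

section construction
set_option linter.unusedSectionVars false
variable {V : Type} [Fintype V] [DecidableEq V] {n : ℕ}

/-- coordinates of `t` incident to `v` -/
def inn (v : V) (t : V × V → Fin (n + 1)) : V × V → Fin (n + 1) :=
  fun e => if e.1 = v ∨ e.2 = v then t e else 0

/-- coordinates of `t` not incident to `v` -/
def out (v : V) (t : V × V → Fin (n + 1)) : V × V → Fin (n + 1) :=
  fun e => if e.1 = v ∨ e.2 = v then 0 else t e

theorem ext_inn_out {v : V} {t s : V × V → Fin (n + 1)} (h1 : inn v t = inn v s)
    (h2 : out v t = out v s) : t = s := by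
  funext e
  have h1 := congrFun h1 e
  have h2 := congrFun h2 e
  simp only [inn, out] at h1 h2
  split_ifs at h1 h2 <;> assumption

theorem inn_update {v : V} {e : V × V} (he : ¬ (e.1 = v ∨ e.2 = v))
    (t : V × V → Fin (n + 1)) (i : Fin (n + 1)) : inn v (Function.update t e i) = inn v t := by
  funext f
  simp only [inn]
  split_ifs with hf
  · rw [Function.update_of_ne]
    rintro rfl
    exact he hf
  · rfl

theorem out_update {v : V} {e : V × V} (he : e.1 = v ∨ e.2 = v)
    (t : V × V → Fin (n + 1)) (i : Fin (n + 1)) : out v (Function.update t e i) = out v t := by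
  funext f
  simp only [out]
  split_ifs with hf
  · rfl
  · rw [Function.update_of_ne]
    rintro rfl
    exact hf he

variable (adj : V → V → Prop) [DecidableRel adj]

/-- the coefficient of the symbols of `u` in the image of a point over `v` -/
def cf (u v : V) : ℤ := if u = v then 1 else if adj u v then -1 else 0

/-- the embedding in a free abelian group -/
def emb (a : V × (V × V → Fin (n + 1))) :
    (V × (V × V → Fin (n + 1))) ⊕ (V × (V × V → Fin (n + 1))) → ℤ :=
  Sum.elim (fun k => if k = (a.1, out a.1 a.2) then 1 else 0)
    (fun k => cf adj k.1 a.1 * if k.2 = inn k.1 a.2 then 1 else 0)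

theorem two_ind {κ : Type} [DecidableEq κ] {a b c d : κ}
    (h : ∀ k, (if k = a then (1:ℤ) else 0) + (if k = b then 1 else 0) =
      (if k = c then 1 else 0) + (if k = d then 1 else 0)) :
    (a = c ∧ b = d) ∨ (a = d ∧ b = c) := by
  have h1 := h a
  have h2 := h b
  have h3 := h c
  have h4 := h d
  grind

theorem emb_P {a b c d : V × (V × V → Fin (n + 1))}
    (h : emb adj a + emb adj b = emb adj c + emb adj d) :
    ((a.1, out a.1 a.2) = (c.1, out c.1 c.2) ∧ (b.1, out b.1 b.2) = (d.1, out d.1 d.2)) ∨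
    ((a.1, out a.1 a.2) = (d.1, out d.1 d.2) ∧ (b.1, out b.1 b.2) = (c.1, out c.1 c.2)) := by
  apply two_ind
  intro k
  have := congrFun h (Sum.inl k)
  simpa [emb] using this

theorem emb_Q {a b c d : V × (V × V → Fin (n + 1))}
    (h : emb adj a + emb adj b = emb adj c + emb adj d) (u : V) (s) :
    cf adj u a.1 * (if s = inn u a.2 then 1 else 0) + cf adj u b.1 * (if s = inn u b.2 then 1 else 0)
    = cf adj u c.1 * (if s = inn u c.2 then 1 else 0) + cf adj u d.1 * (if s = inn u d.2 then 1 else 0)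
    := by
  have := congrFun h (Sum.inr (u, s))
  simpa [emb] using this

theorem emb_loop {a b c d : V × (V × V → Fin (n + 1))}
    (h : emb adj a + emb adj b = emb adj c + emb adj d)
    (hb : b.1 = a.1) (hc : c.1 = a.1) (hd : d.1 = a.1) :
    (inn a.1 c.2 = inn a.1 a.2 ∨ inn a.1 c.2 = inn a.1 b.2) ∧
    (out a.1 c.2 = out a.1 a.2 ∨ out a.1 c.2 = out a.1 b.2) := by
  constructor
  · have := two_ind (a := inn a.1 a.2) (b := inn a.1 b.2) (c := inn a.1 c.2) (d := inn a.1 d.2) (by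
      intro k
      have := emb_Q adj h a.1 k
      simpa [cf, hb, hc, hd] using this)
    grind
  · have := emb_P adj h
    simp only [hb, hc, hd, Prod.mk.injEq, true_and] at this
    grind

/-- the good (distinct and non-adjacent) pairs -/
def gd (v w : V) : Prop := v ≠ w ∧ ¬ adj v w

theorem ind_one {κ : Type} [DecidableEq κ] {a c : κ}
    (h : ∀ k, (if k = a then (1:ℤ) else 0) = (if k = c then 1 else 0)) : a = c := by
  have h1 := h a
  grind

theorem emb_same (hs : ∀ v w, adj v w → adj w v) {a b c d : V × (V × V → Fin (n + 1))}
    (h : emb adj a + emb adj b = emb adj c + emb adj d)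
    (hab : gd adj a.1 b.1)
    (h1 : (a.1, out a.1 a.2) = (c.1, out c.1 c.2)) (h2 : (b.1, out b.1 b.2) = (d.1, out d.1 d.2)) :
    a = c ∧ b = d := by
  simp only [Prod.mk.injEq] at h1 h2
  obtain ⟨a1, a2⟩ := a
  obtain ⟨b1, b2⟩ := b
  obtain ⟨c1, c2⟩ := c
  obtain ⟨d1, d2⟩ := d
  obtain ⟨rfl, h1⟩ := h1
  obtain ⟨rfl, h2⟩ := h2
  have hba : ¬ adj b1 a1 := fun h => hab.2 (hs _ _ h)
  have n1 := hab.1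
  have n2 := hab.2
  simp only at *
  constructor
  · have := ind_one (a := inn a1 a2) (c := inn a1 c2) (by
      intro k
      have := emb_Q adj h a1 k
      simpa [cf, n1, n2] using this)
    rw [ext_inn_out this h1]
  · have := ind_one (a := inn b1 b2) (c := inn b1 d2) (by
      intro k
      have := emb_Q adj h b1 k
      simpa [cf, n1.symm, hba] using this)
    rw [ext_inn_out this h2]

theorem emb_sum (hs : ∀ v w, adj v w → adj w v) {a b c d : V × (V × V → Fin (n + 1))}
    (h : emb adj a + emb adj b = emb adj c + emb adj d)
    (hab : gd adj a.1 b.1) : (a = c ∧ b = d) ∨ (a = d ∧ b = c) := by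
  rcases emb_P adj h with ⟨h1, h2⟩ | ⟨h1, h2⟩
  · exact Or.inl (emb_same adj hs h hab h1 h2)
  · exact Or.inr (emb_same adj hs (h.trans (add_comm _ _)) hab h1 h2)

theorem emb_diff (hs : ∀ v w, adj v w → adj w v) {a b c d : V × (V × V → Fin (n + 1))}
    (h : emb adj a + emb adj d = emb adj c + emb adj b)
    (hab : gd adj a.1 b.1) (_hcd : gd adj c.1 d.1) : a = c ∧ b = d := by
  rcases emb_P adj h with ⟨h1, h2⟩ | ⟨h1, h2⟩
  · have e1 : a.1 = c.1 := (Prod.mk.inj h1).1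
    have e2 : d.1 = b.1 := (Prod.mk.inj h2).1
    have := emb_same adj hs h (by rw [e2]; exact hab) h1 h2
    exact ⟨this.1, this.2.symm⟩
  · exact absurd (Prod.mk.inj h1).1 hab.1

theorem emb_inj {a b : V × (V × V → Fin (n + 1))} (h : emb adj a = emb adj b) : a = b := by
  have hh : emb adj a + emb adj a = emb adj b + emb adj b := by rw [h]
  obtain ⟨a1, a2⟩ := a
  obtain ⟨b1, b2⟩ := b
  have hP : a1 = b1 ∧ out a1 a2 = out b1 b2 := by
    rcases emb_P adj hh with h | h <;> simpa using h.1
  obtain ⟨rfl, h1⟩ := hP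
  have := emb_loop adj hh rfl rfl rfl
  simp only [or_self] at this
  rw [ext_inn_out this.1.symm this.2.symm]

/-- along an edge the sums are constant -/
theorem emb_edge (hs : ∀ v w, adj v w → adj w v) {v w : V} (hne : v ≠ w) (hvw : adj v w)
    (t : V × V → Fin (n + 1)) (i : Fin (n + 1)) :
    emb adj (v, Function.update t (v, w) i) + emb adj (w, Function.update t (v, w) i) =
      emb adj (v, t) + emb adj (w, t) := by
  funext k
  rcases k with k | ⟨u, s⟩
  · simp [emb, out_update]
  · by_cases hu : v = u ∨ w = u
    · rcases hu with rfl | rfl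
      · simp [emb, cf, hne, hvw]
        split_ifs <;> rfl
      · simp [emb, cf, hne.symm, hs _ _ hvw]
        split_ifs <;> rfl
    · simp [emb, inn_update (e := (v, w)) hu]

/-- a popular difference -/
theorem emb_popdiff {v w : V} (hne : v ≠ w) (t : V × V → Fin (n + 1)) (i j k : Fin (n + 1)) :
    emb adj (v, Function.update (Function.update t (w, w) k) (v, v) i) +
      emb adj (v, Function.update t (v, v) j) =
    emb adj (v, Function.update t (v, v) i) +
      emb adj (v, Function.update (Function.update t (w, w) k) (v, v) j) := by
  funext x
  rcases x with x | ⟨u, s⟩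
  · simp [emb, out_update]
    ring
  · by_cases hu : v = u
    · subst hu
      have hc : ∀ x, inn v (Function.update (Function.update t (w, w) k) (v, v) x) =
          inn v (Function.update t (v, v) x) := by
        intro x
        rw [Function.update_comm (by simp [hne.symm])]
        exact inn_update (by simp [hne.symm]) _ _
      simp [emb, hc]
    · simp [emb, inn_update (e := (v, v)) (v := u) (by simp [hu])]
      ring

end construction

theorem line_count {ι : Type} [Fintype ι] [DecidableEq ι] {N : ℕ} (e : ι) (S : Finset (ι → Fin N)) :
    ∑ t : ι → Fin N, #{i | Function.update t e i ∈ S} = N * #S := by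
  have h1 : ∑ t : ι → Fin N, #{i | Function.update t e i ∈ S} =
      #{p : (ι → Fin N) × Fin N | Function.update p.1 e p.2 ∈ S} := by
    simp only [card_filter, Fintype.sum_prod_type]
  have h2 : #{p : (ι → Fin N) × Fin N | Function.update p.1 e p.2 ∈ S} =
      #(S ×ˢ (univ : Finset (Fin N))) := by
    refine Finset.card_nbij' (fun p => (Function.update p.1 e p.2, p.1 e))
      (fun p => (Function.update p.1 e p.2, p.1 e)) ?_ ?_ ?_ ?_
    · intro p hp
      simpa using hp
    · intro p hp
      simpa using hp
    · intro p hp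
      simp
    · intro p hp
      simp
  rw [h1, h2, card_product, card_univ, Fintype.card_fin, mul_comm]

theorem line_bound {ι : Type} [Fintype ι] [DecidableEq ι] {N g : ℕ} (e : ι) (S : Finset (ι → Fin N))
    (h : ∀ t, #{i | Function.update t e i ∈ S} ≤ g) : N * #S ≤ g * Fintype.card (ι → Fin N) := by
  rw [← line_count e S]
  refine (Finset.sum_le_sum fun t _ => h t).trans ?_
  simp [mul_comm]

/-- the polarity graph -/
def padj {q : ℕ} (v w : ZMod q × ZMod q) : Prop := v ≠ w ∧ v.2 + w.2 = v.1 * w.1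

theorem padj_symm {q : ℕ} (v w : ZMod q × ZMod q) (h : padj v w) : padj w v :=
  ⟨h.1.symm, by rw [add_comm, h.2, mul_comm]⟩

theorem padj_k4 {q : ℕ} [Fact q.Prime] (v w x y : ZMod q × ZMod q) :
    ¬ padj v w ∨ ¬ padj v x ∨ ¬ padj v y ∨ ¬ padj w x ∨ ¬ padj w y ∨ ¬ padj x y := by
  by_contra! h
  obtain ⟨⟨h1, -⟩, ⟨-, h2⟩, ⟨-, h3⟩, ⟨-, h4⟩, ⟨-, h5⟩, h6, -⟩ := h
  have e1 : (v.1 - w.1) * (x.1 - y.1) = 0 := by linear_combination h3 + h4 - h5 - h2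
  rcases mul_eq_zero.1 e1 with h | h
  · have := sub_eq_zero.1 h
    exact h1 (Prod.ext this (by linear_combination h2 - h4 + x.1 * h))
  · have := sub_eq_zero.1 h
    exact h6 (Prod.ext this (by linear_combination h2 - h3 + v.1 * h))

theorem padj_ind {q : ℕ} [Fact q.Prime] (D : Finset (ZMod q × ZMod q))
    (hD : ∀ v ∈ D, ∀ w ∈ D, ¬ padj v w) : (#D : ℝ) ^ 2 ≤ 4 * (q : ℝ) ^ 3 := by
  classical
  have hq : (1 : ℝ) ≤ q := by exact_mod_cast (Fact.out : q.Prime).one_lt.le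
  let R : ZMod q × ZMod q → ZMod q × ZMod q → ℝ := fun v w => if v.2 + w.2 = v.1 * w.1 then 1 else 0
  have row : ∀ v, ∑ w, R v w = q := by
    intro v
    simp only [R, Fintype.sum_prod_type]
    have : ∀ x y : ZMod q, (v.2 + y = v.1 * x) ↔ y = v.1 * x - v.2 := by
      intro x y
      constructor
      · intro h; rw [← h]; ring
      · intro h; rw [h]; ring
    simp [this, ZMod.card]
  have codeg : ∀ v v', v ≠ v' → ∑ w, R v w * R v' w ≤ 1 := by
    intro v v' hne
    have : ∀ w, R v w * R v' w = if (v.2 + w.2 = v.1 * w.1 ∧ v'.2 + w.2 = v'.1 * w.1) then 1 else 0 := by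
      intro w
      simp only [R]
      split_ifs <;> simp_all
    simp only [this, Finset.sum_boole]
    norm_cast
    rw [Finset.card_le_one]
    intro a ha b hb
    simp only [mem_filter, mem_univ, true_and] at ha hb
    have e : (v.1 - v'.1) * (a.1 - b.1) = 0 := by
      linear_combination ha.2 - ha.1 + hb.1 - hb.2
    rcases mul_eq_zero.1 e with h | h
    · exact absurd (Prod.ext (sub_eq_zero.1 h) (by linear_combination ha.1 - ha.2 + a.1 * h)) hne
    · exact Prod.ext (sub_eq_zero.1 h) (by linear_combination ha.1 - hb.1 + v.1 * h)
  let deg : ZMod q × ZMod q → ℝ := fun w => ∑ v ∈ D, R v w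
  have s1 : ∑ w, deg w = q * #D := by
    simp only [deg]
    rw [Finset.sum_comm]
    simp [row, mul_comm]
  have s2 : ∑ w, deg w ^ 2 ≤ q * #D + (#D : ℝ) ^ 2 := by
    have : ∑ w, deg w ^ 2 = ∑ v ∈ D, ∑ v' ∈ D, ∑ w, R v w * R v' w := by
      simp only [deg, sq, Finset.sum_mul_sum]
      rw [Finset.sum_comm]
      refine Finset.sum_congr rfl fun v _ => ?_
      rw [Finset.sum_comm]
    rw [this]
    have : ∀ v ∈ D, ∑ v' ∈ D, ∑ w, R v w * R v' w ≤ ∑ v' ∈ D, ((if v = v' then (q : ℝ) else 0) + 1) := by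
      intro v _
      refine Finset.sum_le_sum fun v' _ => ?_
      split_ifs with h
      · subst h
        have : ∀ w, R v w * R v w = R v w := by intro w; simp only [R]; split_ifs <;> simp
        simp only [this, row]
        linarith
      · simpa using codeg v v' h
    refine (Finset.sum_le_sum this).trans (le_of_eq ?_)
    simp [Finset.sum_add_distrib]
    ring
  have hdeg : ∀ w ∈ D, deg w ≤ 1 := by
    intro w hw
    have : deg w ≤ ∑ v ∈ D, if v = w then (1:ℝ) else 0 := by
      refine Finset.sum_le_sum fun v hv => ?_
      simp only [R]
      split_ifs with h1 h2
      · rfl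
      · exact absurd ⟨h2, h1⟩ (hD v hv w hw)
      · norm_num
      · rfl
    refine this.trans ?_
    simp [hw]
  set d : ℝ := (#D : ℝ) with hd
  have hd0 : 0 ≤ d := by positivity
  have s3 : ∑ w, (deg w - d / q) ^ 2 ≤ q * d := by
    have : ∑ w, (deg w - d / q) ^ 2 = ∑ w, deg w ^ 2 - 2 * (d / q) * ∑ w, deg w + (q:ℝ)^2 * (d/q)^2 := by
      rw [Finset.mul_sum, ← Finset.sum_sub_distrib]
      have : (q:ℝ)^2 * (d/q)^2 = ∑ w : ZMod q × ZMod q, (d/q)^2 := by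
        simp [ZMod.card, sq]
      rw [this, ← Finset.sum_add_distrib]
      exact Finset.sum_congr rfl fun w _ => by ring
    rw [this, s1]
    have : 2 * (d / q) * (q * d) = 2 * d^2 := by field_simp
    rw [this]
    have : (q:ℝ)^2 * (d/q)^2 = d^2 := by field_simp
    rw [this]
    linarith
  by_cases hbig : d < 2 * q
  · nlinarith [pow_le_pow_left₀ (by linarith : (0:ℝ) ≤ 1) hq 2, mul_nonneg hd0 hd0]
  push Not at hbig
  have s4 : d * (d / (2 * q)) ^ 2 ≤ q * d := by
    refine le_trans ?_ s3
    refine le_trans ?_ (Finset.sum_le_univ_sum_of_nonneg (s := D) fun w => sq_nonneg _)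
    have : d * (d / (2 * q)) ^ 2 = ∑ w ∈ D, (d / (2 * q)) ^ 2 := by simp [hd]
    rw [this]
    refine Finset.sum_le_sum fun w hw => ?_
    have h1 := hdeg w hw
    have h2 : 1 ≤ d / (2 * q) := by rw [le_div_iff₀ (by positivity)]; linarith
    have h3 : d / q = 2 * (d / (2 * q)) := by field_simp
    rw [h3]
    nlinarith
  have hdpos : 0 < d := by linarith
  have s5 : (d / (2 * q)) ^ 2 ≤ q := by
    have : d * (d / (2 * q)) ^ 2 ≤ d * q := by linarith
    exact le_of_mul_le_mul_left this hdpos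
  rw [div_pow, div_le_iff₀ (by positivity)] at s5
  nlinarith

section main
variable {V : Type} [Fintype V] [DecidableEq V] {n : ℕ}
variable (adj : V → V → Prop) [DecidableRel adj]

theorem four_count {α : Type} (B : Finset α) (f : α → α → ℕ)
    (h : ∀ a b c d, 1 ≤ f a b + f a c + f a d + f b c + f b d + f c d) :
    #B ^ 2 ≤ 6 * ∑ a ∈ B, ∑ b ∈ B, f a b := by
  have h1 : ∑ a ∈ B, ∑ b ∈ B, ∑ c ∈ B, ∑ d ∈ B, 1 ≤
      ∑ a ∈ B, ∑ b ∈ B, ∑ c ∈ B, ∑ d ∈ B, (f a b + f a c + f a d + f b c + f b d + f c d) :=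
    Finset.sum_le_sum fun a _ => Finset.sum_le_sum fun b _ => Finset.sum_le_sum fun c _ =>
      Finset.sum_le_sum fun d _ => h a b c d
  simp only [Finset.sum_add_distrib, Finset.sum_const, smul_eq_mul, ← Finset.mul_sum] at h1
  rcases Nat.eq_zero_or_pos (#B) with h0 | h0
  · simp [h0]
  · have : #B ^ 2 * #B ^ 2 ≤ #B ^ 2 * (6 * ∑ a ∈ B, ∑ b ∈ B, f a b) := by
      nlinarith
    exact Nat.le_of_mul_le_mul_left this (by positivity)

theorem hered (hs : ∀ v w, adj v w → adj w v)
    (hk : ∀ v w x y, ¬ adj v w ∨ ¬ adj v x ∨ ¬ adj v y ∨ ¬ adj w x ∨ ¬ adj w y ∨ ¬ adj x y)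
    (Φ : V × (V × V → Fin (n + 1)) → ℤ)
    (hΦ : ∀ a b c d, Φ a + Φ b = Φ c + Φ d ↔
      emb adj a + emb adj b = emb adj c + emb adj d)
    (B : Finset (V × (V × V → Fin (n + 1)))) :
    #B ^ 2 ≤ 576 * #(B.image Φ + B.image Φ) ∧ #B ^ 2 ≤ 576 * #(B.image Φ - B.image Φ) := by
  classical
  have hinj : Function.Injective Φ := by
    intro a b h
    apply emb_inj adj
    have := (hΦ a a b b).1 (by rw [h])
    funext k
    have := congrFun this k
    simp only [Pi.add_apply] at this
    omega
  have h6 := four_count B (fun a b => if adj a.1 b.1 then 0 else 1) (by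
    intro a b c d
    have := hk a.1 b.1 c.1 d.1
    split_ifs <;> first | omega | (exfalso; tauto))
  have hsplit : ∑ a ∈ B, ∑ b ∈ B, (if adj a.1 b.1 then 0 else 1) ≤
      ∑ a ∈ B, #{b ∈ B | b.1 = a.1} + #{p ∈ B ×ˢ B | gd adj p.1.1 p.2.1} := by
    rw [Finset.card_filter, Finset.sum_product, ← Finset.sum_add_distrib]
    refine Finset.sum_le_sum fun a _ => ?_
    rw [Finset.card_filter, ← Finset.sum_add_distrib]
    refine Finset.sum_le_sum fun b _ => ?_
    by_cases h1 : adj a.1 b.1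
    · simp [h1]
    · by_cases h2 : b.1 = a.1
      · simp [h2]
        split_ifs <;> omega
      · simp [h1, h2, gd, Ne.symm h2]
  by_cases hM : #B ^ 2 ≤ 12 * #{p ∈ B ×ˢ B | gd adj p.1.1 p.2.1}
  · constructor
    · have := Finset.card_le_mul_card_image_of_maps_to
        (s := {p ∈ B ×ˢ B | gd adj p.1.1 p.2.1}) (t := B.image Φ + B.image Φ)
        (f := fun p => Φ p.1 + Φ p.2) (fun p hp => by
          simp only [mem_filter, mem_product] at hp
          exact add_mem_add (mem_image_of_mem _ hp.1.1) (mem_image_of_mem _ hp.1.2)) 2 (fun ξ _ => by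
          rcases Finset.eq_empty_or_nonempty
            {p ∈ {p ∈ B ×ˢ B | gd adj p.1.1 p.2.1} | Φ p.1 + Φ p.2 = ξ} with h0 | ⟨p, hp⟩
          · rw [h0]; simp
          · refine (Finset.card_le_card (t := {p, p.swap}) ?_).trans Finset.card_le_two
            intro r hr
            simp only [mem_filter, mem_product] at hp hr
            have := emb_sum adj hs ((hΦ _ _ _ _).1 (hr.2.trans hp.2.symm)) hr.1.2
            simp only [mem_insert, mem_singleton]
            rcases this with ⟨h1, h2⟩ | ⟨h1, h2⟩
            · exact Or.inl (Prod.ext h1 h2)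
            · exact Or.inr (Prod.ext h1 h2))
      omega
    · have := Finset.card_le_card_of_injOn
        (s := {p ∈ B ×ˢ B | gd adj p.1.1 p.2.1}) (t := B.image Φ - B.image Φ)
        (fun p => Φ p.1 - Φ p.2) (fun p hp => by
          simp only [coe_filter, Set.mem_ofPred_eq, mem_product] at hp
          exact sub_mem_sub (mem_image_of_mem _ hp.1.1) (mem_image_of_mem _ hp.1.2)) (by
          intro p hp r hr h
          simp only [coe_filter, Set.mem_ofPred_eq, mem_product] at hp hr h
          have := emb_diff adj hs (a := p.1) (b := p.2) (c := r.1) (d := r.2)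
            ((hΦ _ _ _ _).1 (by linarith)) hp.2 hr.2
          exact Prod.ext this.1 this.2)
      omega
  · have hL : #B ^ 2 ≤ 12 * ∑ a ∈ B, #{b ∈ B | b.1 = a.1} := by omega
    rcases B.eq_empty_or_nonempty with h0 | h0
    · simp [h0]
    obtain ⟨a, ha, hma⟩ : ∃ a ∈ B, #B ≤ 12 * #{b ∈ B | b.1 = a.1} := by
      by_contra! hcon
      have := Finset.sum_lt_sum_of_nonempty h0 hcon
      rw [← Finset.mul_sum, Finset.sum_const, smul_eq_mul, ← sq] at this
      omega
    set Ba := {b ∈ B | b.1 = a.1} with hBa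
    have hcard : #(Ba.image Φ) = #Ba := Finset.card_image_of_injective _ hinj
    have hE := energy_lemma (Ba.image Φ) (by
      intro ξ
      rcases Finset.eq_empty_or_nonempty
        {p ∈ Ba.image Φ ×ˢ Ba.image Φ | p.1 + p.2 = ξ} with h0 | ⟨p, hp⟩
      · rw [h0]; simp
      simp only [mem_filter, mem_product, mem_image] at hp
      obtain ⟨⟨⟨a0, ha0, hpa⟩, b0, hb0, hpb⟩, hξ⟩ := hp
      rw [← hpa, ← hpb] at hξ
      have va0 : a0.1 = a.1 := (mem_filter.1 ha0).2
      have vb0 : b0.1 = a.1 := (mem_filter.1 hb0).2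
      let C : Finset (V × (V × V → Fin (n + 1))) :=
        {c ∈ Ba | (inn a.1 c.2 = inn a.1 a0.2 ∨ inn a.1 c.2 = inn a.1 b0.2) ∧
          (out a.1 c.2 = out a.1 a0.2 ∨ out a.1 c.2 = out a.1 b0.2)}
      have hC : #C ≤ 4 := by
        have : #C ≤ #(({inn a.1 a0.2, inn a.1 b0.2} : Finset (V × V → Fin (n + 1))) ×ˢ
            ({out a.1 a0.2, out a.1 b0.2} : Finset (V × V → Fin (n + 1)))) := by
          refine Finset.card_le_card_of_injOn (fun c => (inn a.1 c.2, out a.1 c.2)) ?_ ?_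
          · intro c hc
            have := (mem_filter.1 (mem_coe.1 hc)).2
            simpa using this
          · intro c hc c' hc' h
            have e1 : c.1 = a.1 := (mem_filter.1 (mem_filter.1 (mem_coe.1 hc)).1).2
            have e2 : c'.1 = a.1 := (mem_filter.1 (mem_filter.1 (mem_coe.1 hc')).1).2
            have := Prod.mk.inj h
            exact Prod.ext (e1.trans e2.symm) (ext_inn_out this.1 this.2)
        rw [card_product] at this
        exact this.trans (Nat.mul_le_mul card_le_two card_le_two)
      refine le_trans ?_ ((Finset.card_image_le (s := C) (f := Φ)).trans hC)
      refine Finset.card_le_card_of_injOn (fun p => p.1) ?_ ?_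
      · intro r hr
        simp only [coe_filter, Set.mem_ofPred_eq, mem_product, mem_image] at hr
        obtain ⟨⟨⟨c, hc, hrc⟩, d, hd, hrd⟩, hr⟩ := hr
        rw [← hrc, ← hrd] at hr
        have vc : c.1 = a.1 := (mem_filter.1 hc).2
        have vd : d.1 = a.1 := (mem_filter.1 hd).2
        have := emb_loop adj ((hΦ a0 b0 c d).1 (hξ.trans hr.symm)) (vb0.trans va0.symm)
          (vc.trans va0.symm) (vd.trans va0.symm)
        rw [va0] at this
        exact mem_coe.2 (mem_image.2 ⟨c, mem_filter.2 ⟨hc, this⟩, hrc⟩)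
      · intro r hr r' hr' h
        simp only [coe_filter, Set.mem_ofPred_eq] at hr hr' h
        exact Prod.ext h (by linarith [hr.2, hr'.2]))
    rw [hcard] at hE
    have hsub : Ba.image Φ ⊆ B.image Φ := Finset.image_subset_image (Finset.filter_subset _ _)
    have c1 := Finset.card_le_card (Finset.add_subset_add hsub hsub)
    have c2 := Finset.card_le_card (Finset.sub_subset_sub hsub hsub)
    have c3 : #B ^ 2 ≤ 144 * #Ba ^ 2 := by nlinarith
    constructor <;> omega

theorem dense_sum {δ : ℝ} (g : ℕ) (hδ : 0 < δ)
    (hn : 2 * (Fintype.card V : ℝ) ^ 2 * g < δ * (n + 1 : ℕ))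
    (hind : ∀ S : Finset V, (∀ v ∈ S, ∀ w ∈ S, ¬ adj v w) → (#S : ℝ) ≤ δ / 2 * Fintype.card V)
    [Nonempty V] (D : Finset (V × (V × V → Fin (n + 1))))
    (hD : δ * Fintype.card (V × (V × V → Fin (n + 1))) ≤ #D) :
    ∃ v w t, adj v w ∧ g < #{i | (v, Function.update t (v, w) i) ∈ D ∧
      (w, Function.update t (v, w) i) ∈ D} := by
  classical
  by_contra! hcon
  let G : V → V → Finset (V × V → Fin (n + 1)) := fun v w => {t | (v, t) ∈ D ∧ (w, t) ∈ D}
  have hG : ∀ v w, adj v w → (n + 1) * #(G v w) ≤ g * Fintype.card (V × V → Fin (n + 1)) := by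
    intro v w h
    refine line_bound (v, w) _ fun t => ?_
    simpa [G] using hcon v w t h
  set T : ℝ := (Fintype.card (V × V → Fin (n + 1)) : ℝ) with hT
  have hTpos : 0 < T := by rw [hT]; exact_mod_cast Fintype.card_pos
  set c : ℝ := (Fintype.card V : ℝ) with hc
  have hcpos : 0 < c := by rw [hc]; exact_mod_cast Fintype.card_pos
  have hslice : (#D : ℝ) = ∑ t : V × V → Fin (n + 1), (#{v | (v, t) ∈ D} : ℝ) := by
    norm_cast
    have : #D = #{p : V × (V × V → Fin (n + 1)) | p ∈ D} := by simp
    rw [this, Finset.card_filter, Fintype.sum_prod_type, Finset.sum_comm]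
    simp only [Finset.card_filter]
  have hb : ∀ t : V × V → Fin (n + 1), (#{v | (v, t) ∈ D} : ℝ) ≤
      δ / 2 * c + c * ∑ v, ∑ w, (if adj v w ∧ t ∈ G v w then (1:ℝ) else 0) := by
    intro t
    by_cases h : ∃ v w, adj v w ∧ t ∈ G v w
    · obtain ⟨v, w, h⟩ := h
      have h1 : (1:ℝ) ≤ ∑ v, ∑ w, (if adj v w ∧ t ∈ G v w then (1:ℝ) else 0) := by
        calc (1:ℝ) = if adj v w ∧ t ∈ G v w then (1:ℝ) else 0 := by rw [if_pos h]
          _ ≤ ∑ w, (if adj v w ∧ t ∈ G v w then (1:ℝ) else 0) :=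
            Finset.single_le_sum (f := fun w => if adj v w ∧ t ∈ G v w then (1:ℝ) else 0)
              (fun i _ => by split_ifs <;> norm_num) (mem_univ w)
          _ ≤ _ := Finset.single_le_sum
              (f := fun v => ∑ w, (if adj v w ∧ t ∈ G v w then (1:ℝ) else 0))
              (fun i _ => Finset.sum_nonneg fun j _ => by split_ifs <;> norm_num) (mem_univ v)
      have h2 : (#{v | (v, t) ∈ D} : ℝ) ≤ c := by
        rw [hc]; exact_mod_cast Finset.card_le_univ _
      nlinarith [mul_pos (half_pos hδ) hcpos]
    · push Not at h
      have h1 := hind {v | (v, t) ∈ D} (by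
        intro v hv w hw hvw
        exact h v w hvw (by simp at hv hw; simp [G, hv, hw]))
      have h2 : (0:ℝ) ≤ ∑ v, ∑ w, (if adj v w ∧ t ∈ G v w then (1:ℝ) else 0) :=
        Finset.sum_nonneg fun i _ => Finset.sum_nonneg fun j _ => by split_ifs <;> norm_num
      nlinarith
  have hsum : (#D : ℝ) ≤ T * (δ / 2 * c) +
      c * ∑ v, ∑ w, (if adj v w then (#(G v w) : ℝ) else 0) := by
    rw [hslice]
    refine (Finset.sum_le_sum fun t _ => hb t).trans (le_of_eq ?_)
    rw [Finset.sum_add_distrib]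
    congr 1
    · rw [Finset.sum_const, card_univ, nsmul_eq_mul]
    · rw [← Finset.mul_sum]
      congr 1
      rw [Finset.sum_comm]
      refine Finset.sum_congr rfl fun v _ => ?_
      rw [Finset.sum_comm]
      refine Finset.sum_congr rfl fun w _ => ?_
      by_cases h : adj v w <;> simp [h]
  have hGs : (n + 1 : ℕ) * ∑ v, ∑ w, (if adj v w then (#(G v w) : ℝ) else 0) ≤ c ^ 2 * (g * T) := by
    rw [Finset.mul_sum]
    have : ∀ v ∈ (univ : Finset V), ((n + 1 : ℕ) : ℝ) * ∑ w, (if adj v w then (#(G v w) : ℝ) else 0) ≤ c * (g * T) := by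
      intro v _
      rw [Finset.mul_sum]
      refine (Finset.sum_le_sum (g := fun _ => (g * T : ℝ)) fun w _ => ?_).trans (le_of_eq ?_)
      · split_ifs with h
        · rw [hT]; exact_mod_cast hG v w h
        · rw [mul_zero]; positivity
      · simp [hc]
    refine (Finset.sum_le_sum this).trans (le_of_eq ?_)
    simp [hc]; ring
  rw [Fintype.card_prod] at hD
  push_cast at hD
  rw [← hc] at hD
  have hD' : δ * (c * T) ≤ #D := by rw [hT]; exact_mod_cast hD
  have k1 : δ / 2 * T ≤ ∑ v, ∑ w, (if adj v w then (#(G v w) : ℝ) else 0) := by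
    have : c * (δ / 2 * T) ≤ c * ∑ v, ∑ w, (if adj v w then (#(G v w) : ℝ) else 0) := by nlinarith
    exact le_of_mul_le_mul_left this hcpos
  have hN : (0:ℝ) < ((n + 1 : ℕ) : ℝ) := by positivity
  have k2 : ((n + 1 : ℕ) : ℝ) * (δ / 2 * T) ≤ c ^ 2 * (g * T) :=
    (mul_le_mul_of_nonneg_left k1 hN.le).trans hGs
  have k3 : T * (δ * ((n + 1 : ℕ) : ℝ)) ≤ T * (2 * c ^ 2 * g) := by linarith
  have := le_of_mul_le_mul_left k3 hTpos
  linarith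

theorem dense_diff {δ : ℝ} (g : ℕ) (hδ : 0 < δ)
    (hn : (g + 1 : ℝ) < δ ^ 2 * (n + 1 : ℕ)) [Nontrivial V]
    (D : Finset (V × (V × V → Fin (n + 1))))
    (hD : δ * Fintype.card (V × (V × V → Fin (n + 1))) ≤ #D) :
    ∃ v w t i j, v ≠ w ∧ i ≠ j ∧
      g < #{k | (v, Function.update (Function.update t (w, w) k) (v, v) i) ∈ D ∧
        (v, Function.update (Function.update t (w, w) k) (v, v) j) ∈ D} := by
  classical
  by_contra! hcon
  set T : ℝ := (Fintype.card (V × V → Fin (n + 1)) : ℝ) with hT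
  have hTpos : 0 < T := by rw [hT]; exact_mod_cast Fintype.card_pos
  set N : ℝ := ((n + 1 : ℕ) : ℝ) with hN
  have hNpos : 0 < N := by positivity
  have hslice : (#D : ℝ) = ∑ v : V, (#{t | (v, t) ∈ D} : ℝ) := by
    norm_cast
    have : #D = #{p : V × (V × V → Fin (n + 1)) | p ∈ D} := by simp
    rw [this, Finset.card_filter, Fintype.sum_prod_type]
    simp only [Finset.card_filter]
  obtain ⟨v, hv⟩ : ∃ v : V, δ * T ≤ (#{t | (v, t) ∈ D} : ℝ) := by
    by_contra! h
    have := Finset.sum_lt_sum_of_nonempty (s := (univ : Finset V)) univ_nonempty (fun v _ => h v)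
    rw [← hslice] at this
    rw [Fintype.card_prod] at hD
    push_cast at hD
    simp at this
    rw [hT] at this
    push_cast [Fintype.card_fun] at this hD
    simp at this hD
    linarith
  obtain ⟨w, hw⟩ := exists_ne v
  set S : Finset (V × V → Fin (n + 1)) := {t | (v, t) ∈ D} with hS
  let a : (V × V → Fin (n + 1)) → ℝ := fun t => (#{i | Function.update t (v, v) i ∈ S} : ℝ)
  let F : Fin (n + 1) → Fin (n + 1) → Finset (V × V → Fin (n + 1)) := fun i j =>
    {t | Function.update t (v, v) i ∈ S ∧ Function.update t (v, v) j ∈ S}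
  have hF : ∀ i j, i ≠ j → N * #(F i j) ≤ g * T := by
    intro i j hij
    rw [hN, hT]
    norm_cast
    refine line_bound (w, w) _ fun t => ?_
    simpa [F, hS] using hcon v w t i j hw.symm hij
  have ha1 : ∑ t, a t = N * #S := by
    rw [hN]
    simp only [a]
    exact_mod_cast line_count (v, v) S
  have haN : ∀ t, a t ≤ N := by
    intro t
    simp only [a, hN]
    exact_mod_cast (Finset.card_le_univ _).trans (by simp)
  have ha2 : ∑ t, a t ^ 2 ≤ N * T + N * (g * T) := by
    have e1 : ∀ t, a t ^ 2 = ∑ i, ∑ j, (if t ∈ F i j then (1:ℝ) else 0) := by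
      intro t
      have : a t = ∑ i, if Function.update t (v, v) i ∈ S then (1:ℝ) else 0 := by
        simp [a]
      rw [this, sq, Finset.sum_mul_sum]
      refine Finset.sum_congr rfl fun i _ => Finset.sum_congr rfl fun j _ => ?_
      by_cases h1 : Function.update t (v, v) i ∈ S <;>
        by_cases h2 : Function.update t (v, v) j ∈ S <;> simp [F, h1, h2]
    have e2 : ∑ t, a t ^ 2 = ∑ i, ∑ j, (#(F i j) : ℝ) := by
      simp only [e1]
      rw [Finset.sum_comm]
      refine Finset.sum_congr rfl fun i _ => ?_
      rw [Finset.sum_comm]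
      refine Finset.sum_congr rfl fun j _ => ?_
      simp
    rw [e2]
    have e3 : ∀ i ∈ (univ : Finset (Fin (n + 1))), ∑ j, (#(F i j) : ℝ) ≤
        ∑ j, ((if i = j then T else 0) + g * T / N) := by
      intro i _
      refine Finset.sum_le_sum fun j _ => ?_
      by_cases h : i = j
      · rw [if_pos h]
        have : (#(F i j) : ℝ) ≤ T := by rw [hT]; exact_mod_cast Finset.card_le_univ _
        have : (0:ℝ) ≤ g * T / N := by positivity
        linarith
      · rw [if_neg h, zero_add, le_div_iff₀ hNpos, mul_comm]
        exact hF i j h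
    refine (Finset.sum_le_sum e3).trans (le_of_eq ?_)
    simp only [Finset.sum_add_distrib, Finset.sum_ite_eq, mem_univ, if_true, Finset.sum_const,
      card_univ, Fintype.card_fin, nsmul_eq_mul, ← hN]
    field_simp
  have ha3 : (δ * N) ^ 2 * T ≤ ∑ t, a t ^ 2 := by
    have e1 : ∑ t, (2 * (δ * N) * a t - (δ * N) ^ 2) ≤ ∑ t, a t ^ 2 :=
      Finset.sum_le_sum fun t _ => by nlinarith [sq_nonneg (a t - δ * N)]
    rw [Finset.sum_sub_distrib, ← Finset.mul_sum, ha1, Finset.sum_const, nsmul_eq_mul, card_univ,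
      ← hT] at e1
    have e2 : 2 * (δ * N) * (N * (δ * T)) ≤ 2 * (δ * N) * (N * #S) := by gcongr
    nlinarith
  have k : N * T * (δ ^ 2 * N) ≤ N * T * (g + 1) := by nlinarith
  have := le_of_mul_le_mul_left k (by positivity)
  linarith

end main

section fin

theorem main_aux (g : ℕ) (δ' : ℝ) (hδ : 0 < δ') :
    ∃ A : Set ℤ, A.Finite ∧ A.Nonempty ∧
      (∀ A' ⊆ A,
        (1 / 576 : ℝ) * (A'.ncard : ℝ) ^ 2 ≤ ((A' + A').ncard : ℝ) ∧
        (1 / 576 : ℝ) * (A'.ncard : ℝ) ^ 2 ≤ ((A' - A').ncard : ℝ)) ∧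
      ∀ A'' ⊆ A, δ' * (A.ncard : ℝ) ≤ (A''.ncard : ℝ) →
        ¬ IsB2 g A'' ∧ ¬ IsB2Circ g A'' := by
  classical
  obtain ⟨m, hm⟩ := exists_nat_gt (16 / δ' ^ 2)
  obtain ⟨q, hqm, hq⟩ := Nat.exists_infinite_primes m
  have : Fact q.Prime := ⟨hq⟩
  have hqm' : 16 / δ' ^ 2 < (q : ℝ) := hm.trans_le (by exact_mod_cast hqm)
  have hq0 : (0 : ℝ) < q := by exact_mod_cast hq.pos
  have hq16 : 16 < δ' ^ 2 * q := by
    rw [div_lt_iff₀ (by positivity)] at hqm'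
    linarith
  have hcV : (Fintype.card (ZMod q × ZMod q) : ℝ) = (q : ℝ) ^ 2 := by
    rw [Fintype.card_prod, ZMod.card]; push_cast; ring
  have hind : ∀ S : Finset (ZMod q × ZMod q), (∀ v ∈ S, ∀ w ∈ S, ¬ padj v w) →
      (#S : ℝ) ≤ δ' / 2 * Fintype.card (ZMod q × ZMod q) := by
    intro S hS
    have h := padj_ind S hS
    rw [hcV]
    refine (pow_le_pow_iff_left₀ (by positivity) (by positivity) two_ne_zero).1 ?_
    refine h.trans ?_
    have : 16 * (q : ℝ) ^ 3 ≤ δ' ^ 2 * q * (q : ℝ) ^ 3 := by gcongr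
    nlinarith
  obtain ⟨n1, hn1⟩ := exists_nat_gt (2 * (Fintype.card (ZMod q × ZMod q) : ℝ) ^ 2 * g / δ')
  obtain ⟨n2, hn2⟩ := exists_nat_gt ((g + 1 : ℝ) / δ' ^ 2)
  let n := n1 + n2
  have hna : 2 * (Fintype.card (ZMod q × ZMod q) : ℝ) ^ 2 * g < δ' * (n + 1 : ℕ) := by
    rw [div_lt_iff₀ hδ] at hn1
    have : (n1 : ℝ) ≤ (n + 1 : ℕ) := by simp only [n]; push_cast; linarith [n2.cast_nonneg (α := ℝ)]
    nlinarith
  have hnb : (g + 1 : ℝ) < δ' ^ 2 * (n + 1 : ℕ) := by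
    rw [div_lt_iff₀ (by positivity)] at hn2
    have : (n2 : ℝ) ≤ (n + 1 : ℕ) := by simp only [n]; push_cast; linarith [n1.cast_nonneg (α := ℝ)]
    have h2 : 0 < δ' ^ 2 := by positivity
    nlinarith
  clear_value n
  obtain ⟨Φ, hΦ⟩ := exists_model (emb (n := n) (padj (q := q)))
  have hinj : Function.Injective Φ := by
    intro a b h
    apply emb_inj padj
    have := (hΦ a a b b).1 (by rw [h])
    funext k
    have := congrFun this k
    simp only [Pi.add_apply] at this
    omega
  have hrep : ∀ A' ⊆ Set.range Φ, ∃ B : Finset ((ZMod q × ZMod q) ×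
      ((ZMod q × ZMod q) × (ZMod q × ZMod q) → Fin (n + 1))),
      A' = ((B.image Φ : Finset ℤ) : Set ℤ) ∧ A'.ncard = #B ∧ ∀ p, p ∈ B ↔ Φ p ∈ A' := by
    intro A' hA'
    have h1 : A' = (((Finset.univ.filter (fun p => Φ p ∈ A')).image Φ : Finset ℤ) : Set ℤ) := by
      ext x
      simp only [coe_image, coe_filter, mem_univ, true_and, Set.mem_image]
      constructor
      · intro hx
        obtain ⟨p, rfl⟩ := hA' hx
        exact ⟨p, hx, rfl⟩
      · rintro ⟨p, hp, rfl⟩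
        exact hp
    refine ⟨Finset.univ.filter (fun p => Φ p ∈ A'), h1, ?_, by simp⟩
    conv_lhs => rw [h1]
    rw [Set.ncard_coe_finset, Finset.card_image_of_injective _ hinj]
  have hAc : (Set.range Φ).ncard = Fintype.card ((ZMod q × ZMod q) ×
      ((ZMod q × ZMod q) × (ZMod q × ZMod q) → Fin (n + 1))) := by
    rw [← Set.image_univ, Set.ncard_image_of_injective _ hinj, Set.ncard_univ,
      Nat.card_eq_fintype_card]
  refine ⟨Set.range Φ, Set.finite_range _, Set.range_nonempty _, ?_, ?_⟩
  · intro A' hA'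
    obtain ⟨B, hB, hc, -⟩ := hrep A' hA'
    have h := hered padj padj_symm padj_k4 Φ hΦ B
    rw [hc, hB, ← Finset.coe_add, ← Finset.coe_sub, Set.ncard_coe_finset, Set.ncard_coe_finset]
    have h1 : (#B : ℝ) ^ 2 ≤ 576 * #(B.image Φ + B.image Φ) := by exact_mod_cast h.1
    have h2 : (#B : ℝ) ^ 2 ≤ 576 * #(B.image Φ - B.image Φ) := by exact_mod_cast h.2
    constructor <;> linarith
  · intro A' hA' hd
    obtain ⟨B, hB, hc, hmem⟩ := hrep A' hA'
    rw [hc, hAc] at hd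
    constructor
    · intro hb
      obtain ⟨v, w, t, hvw, hg⟩ := dense_sum padj g hδ hna hind B hd
      have hle := hb (Φ (v, t) + Φ (w, t))
      refine absurd hle (not_le.2 (lt_of_lt_of_le (Nat.cast_lt.2 hg) ?_))
      ·
        rw [← Set.encard_coe_eq_coe_finsetCard,
          ← (Set.InjOn.encard_image (f := fun i => s(Φ (v, Function.update t (v, w) i),
            Φ (w, Function.update t (v, w) i))) (by
            intro i _ j _ h
            rcases Sym2.eq_iff.1 h with ⟨h1, -⟩ | ⟨h1, -⟩
            · have := congrFun (Prod.mk.inj (hinj h1)).2 (v, w)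
              simpa using this
            · exact absurd (Prod.mk.inj (hinj h1)).1 hvw.1))]
        refine Set.encard_le_encard (t := {p : Sym2 ℤ | ∃ a ∈ A', ∃ b ∈ A', p = s(a, b) ∧
          a + b = Φ (v, t) + Φ (w, t)}) ?_
        rintro _ ⟨i, hi, rfl⟩
        simp only [coe_filter, mem_univ, true_and, Set.mem_ofPred_eq] at hi
        exact ⟨_, (hmem _).1 hi.1, _, (hmem _).1 hi.2, rfl,
          (hΦ _ _ _ _).2 (emb_edge padj padj_symm hvw.1 hvw t i)⟩
    · intro hb
      obtain ⟨v, w, t, i, j, hvw, hij, hg⟩ := dense_diff g hδ hnb B hd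
      have hle := hb (Φ (v, Function.update t (v, v) i) - Φ (v, Function.update t (v, v) j)) (by
        intro h0
        have := congrFun (Prod.mk.inj (hinj (sub_eq_zero.1 h0))).2 (v, v)
        exact hij (by simpa using this))
      refine absurd hle (not_le.2 (lt_of_lt_of_le (Nat.cast_lt.2 hg) ?_))
      ·
        rw [← Set.encard_coe_eq_coe_finsetCard,
          ← (Set.InjOn.encard_image (f := fun k =>
            (Φ (v, Function.update (Function.update t (w, w) k) (v, v) i),
            Φ (v, Function.update (Function.update t (w, w) k) (v, v) j))) (by
            intro k _ l _ h
            have := congrFun (Prod.mk.inj (hinj (Prod.mk.inj h).1)).2 (w, w)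
            have hne : (w, w) ≠ (v, v) := fun h => hvw (Prod.mk.inj h).1.symm
            rw [Function.update_of_ne hne, Function.update_of_ne hne] at this
            simpa using this))]
        refine Set.encard_le_encard (t := {p : ℤ × ℤ | p.1 ∈ A' ∧ p.2 ∈ A' ∧ p.1 - p.2 =
          Φ (v, Function.update t (v, v) i) - Φ (v, Function.update t (v, v) j)}) ?_
        rintro _ ⟨k, hk, rfl⟩
        simp only [coe_filter, mem_univ, true_and, Set.mem_ofPred_eq] at hk
        have := (hΦ _ _ _ _).2 (emb_popdiff padj hvw t i j k)
        exact ⟨(hmem _).1 hk.1, (hmem _).1 hk.2, by dsimp only; linarith⟩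

end fin

end helpers

theorem stmt_10 :
    ∃ δ : ℝ, 0 < δ ∧
      ∀ g : ℕ, 0 < g → ∀ δ' : ℝ, 0 < δ' →
        ∃ A : Set ℤ, A.Finite ∧ A.Nonempty ∧
          (∀ A' ⊆ A,
            δ * (A'.ncard : ℝ) ^ 2 ≤ ((A' + A').ncard : ℝ) ∧
            δ * (A'.ncard : ℝ) ^ 2 ≤ ((A' - A').ncard : ℝ)) ∧
          ∀ A'' ⊆ A, δ' * (A.ncard : ℝ) ≤ (A''.ncard : ℝ) →
            ¬ IsB2 g A'' ∧ ¬ IsB2Circ g A'' := by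
  exact ⟨1 / 576, by norm_num, fun g _ δ' hδ => main_aux g δ' hδ⟩
end
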